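/- arXiv:1808.09832 — 3 statements merged into one kernel-verified Lean document; each statement's English description precedes it below -/
import Mathlib

section
/- Let G be a finite group and P a set of prime numbers. Let RO_P(G) denote the set of ℤ_(P)-linear combinations, inside the ring of functions G → ℂ with pointwise operations, of characters of finite-dimensional real representations of G (values viewed in ℂ via ℝ ⊆ ℂ); it is a subring of RU_P(G). Then the primitive idempotent elements of RO_P(G) are precisely the functions e_C, where C ranges over representatives of the conjugacy classes of cyclic P-perfect subgroups of G. -/
open scoped Classical

/-- The subring `ℤ_(P) = ℤ[1/p : p ∉ P]` of `ℚ`, viewed inside `ℂ`. -/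
noncomputable def ZPloc (P : Set ℕ) : Subring ℂ :=
  Subring.closure {z : ℂ | ∃ p : ℕ, p.Prime ∧ p ∉ P ∧ z = (p : ℂ)⁻¹}

/-- `b` is the `P'`-part of `g`. -/
def IsPPrimePart {G : Type} [Group G] (P : Set ℕ) (g b : G) : Prop :=
  b ∈ Subgroup.zpowers g ∧
    (∀ p : ℕ, p.Prime → p ∣ orderOf b → p ∉ P) ∧
    (∀ p : ℕ, p.Prime → p ∣ orderOf (g * b⁻¹) → p ∈ P)

/-- Two subgroups of `G` are conjugate in `G`. -/
def SubConj {G : Type} [Group G] (C C' : Subgroup G) : Prop :=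
  ∃ g : G, Subgroup.map (MulAut.conj g).toMonoidHom C = C'

/-- `C` is a cyclic subgroup whose order is not divisible by any prime in `P`. -/
def CyclicPPerfect {G : Type} [Group G] (P : Set ℕ) (C : Subgroup G) : Prop :=
  IsCyclic C ∧ ∀ p : ℕ, p.Prime → p ∈ P → ¬ p ∣ Nat.card C

/-- The idempotent class function `e_C : G → ℂ`, equal to `1` at `g` iff `⟨g_{P'}⟩` is
conjugate in `G` to `C`, and `0` otherwise. -/
noncomputable def eIdem {G : Type} [Group G] (P : Set ℕ) (C : Subgroup G) : G → ℂ :=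
  fun g => if ∃ b : G, IsPPrimePart P g b ∧ SubConj (Subgroup.zpowers b) C then 1 else 0

/-- `RU_P(G)`: the set of `ℤ_(P)`-linear combinations, inside the ring of functions
`G → ℂ`, of characters of finite-dimensional complex representations of `G`. -/
noncomputable def RUP (G : Type) [Group G] [Fintype G] (P : Set ℕ) : Set (G → ℂ) :=
  {f | ∃ (n : ℕ) (c : Fin n → ℂ) (V : Fin n → FDRep ℂ G),
    (∀ i, c i ∈ ZPloc P) ∧ f = ∑ i, c i • (V i).character}

/-- `RO_P(G)`: `ℤ_(P)`-linear combinations of characters of finite-dimensional *real*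
representations of `G`, viewed as functions `G → ℂ` via `ℝ ⊆ ℂ`. -/
noncomputable def ROP (G : Type) [Group G] [Fintype G] (P : Set ℕ) : Set (G → ℂ) :=
  {f | ∃ (n : ℕ) (c : Fin n → ℂ) (V : Fin n → FDRep ℝ G),
    (∀ i, c i ∈ ZPloc P) ∧ f = ∑ i, c i • fun g => ((V i).character g : ℂ)}

/-- `e` is a primitive idempotent of the (sub)ring with underlying set `S`. -/
def IsPrimitiveIdempotentIn {G : Type} (S : Set (G → ℂ)) (e : G → ℂ) : Prop :=
  e ∈ S ∧ e * e = e ∧ e ≠ 0 ∧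
    ∀ e₁ e₂ : G → ℂ, e₁ ∈ S → e₂ ∈ S → e₁ * e₁ = e₁ → e₂ * e₂ = e₂ → e₁ * e₂ = 0 →
      e = e₁ + e₂ → e₁ = 0 ∨ e₂ = 0

section RealCharacters

variable {G : Type} [Group G]

/-- The characters of finite-dimensional real representations, with values viewed in `ℂ`. -/
def realCharacters (G : Type) [Group G] : Set (G → ℂ) :=
  Set.range fun (V : FDRep ℝ G) (g : G) => (V.character g : ℂ)

/-- The representation of `G` on real-valued functions on a `G`-set. -/
noncomputable def permutationRep (G X : Type) [Group G] [MulAction G X] :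
    G →* (X → ℝ) →ₗ[ℝ] (X → ℝ) where
  toFun g := LinearMap.funLeft ℝ ℝ fun x => g⁻¹ • x
  map_one' := by
    ext
    simp [LinearMap.funLeft]
  map_mul' g h := by
    refine LinearMap.ext fun f => funext fun x => ?_
    simp [LinearMap.funLeft_apply, mul_smul]

theorem trace_permutationRep {X : Type} [MulAction G X] [Fintype X] (g : G) :
    LinearMap.trace ℝ (X → ℝ) (permutationRep G X g) =
      (Nat.card (MulAction.fixedBy X g) : ℝ) := by
  rw [LinearMap.trace_eq_matrix_trace ℝ (Pi.basisFun ℝ X), Matrix.trace]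
  have hdiag : ∀ x : X, Matrix.diag (LinearMap.toMatrix (Pi.basisFun ℝ X) (Pi.basisFun ℝ X)
      (permutationRep G X g)) x = if x ∈ MulAction.fixedBy X g then 1 else 0 := by
    intro x
    simp [permutationRep, LinearMap.funLeft_apply, Pi.single_apply, inv_smul_eq_iff,
      eq_comm (a := x)]
  rw [Finset.sum_congr rfl fun x _ => hdiag x, Finset.sum_boole, Nat.card_eq_fintype_card,
    Fintype.card_subtype]

theorem card_fixedBy_mem_realCharacters (X : Type) [MulAction G X] [Finite X] :
    (fun g : G => (Nat.card (MulAction.fixedBy X g) : ℂ)) ∈ realCharacters G := by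
  have := Fintype.ofFinite X
  refine ⟨FDRep.of (permutationRep G X), funext fun g => ?_⟩
  have h := trace_permutationRep (X := X) g
  simp only [FDRep.character]
  erw [h]
  simp

theorem one_mem_realCharacters : (1 : G → ℂ) ∈ realCharacters G := by
  convert card_fixedBy_mem_realCharacters (G := G) (G ⧸ (⊤ : Subgroup G)) using 1
  funext g
  have := QuotientGroup.subsingleton_quotient_top (G := G)
  have : MulAction.fixedBy (G ⧸ (⊤ : Subgroup G)) g = Set.univ :=
    Set.eq_univ_of_forall fun _ => Subsingleton.elim _ _
  simp [this]

theorem mul_mem_realCharacters {f f' : G → ℂ} (hf : f ∈ realCharacters G)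
    (hf' : f' ∈ realCharacters G) : f * f' ∈ realCharacters G := by
  obtain ⟨V, rfl⟩ := hf
  obtain ⟨W, rfl⟩ := hf'
  refine ⟨CategoryTheory.MonoidalCategory.tensorObj V W, ?_⟩
  funext g
  simp [FDRep.char_tensor]

theorem ROP_eq_span [Fintype G] (P : Set ℕ) :
    ROP G P = Submodule.span (ZPloc P) (realCharacters G) := by
  ext f
  rw [SetLike.mem_coe]
  constructor
  · rintro ⟨n, c, V, hc, rfl⟩
    exact Submodule.sum_mem _ fun i _ =>
      Submodule.smul_mem _ (⟨c i, hc i⟩ : ZPloc P) (Submodule.subset_span ⟨V i, rfl⟩)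
  · rw [Submodule.mem_span_set']
    rintro ⟨n, c, v, rfl⟩
    choose V hV using fun i => (v i).2
    refine ⟨n, fun i => c i, V, fun i => (c i).2, Finset.sum_congr rfl fun i _ => ?_⟩
    rw [← hV i]
    rfl

/-- `RO_P(G)` as a subalgebra of the ring of functions `G → ℂ`. -/
noncomputable def ROPSubalgebra (G : Type) [Group G] (P : Set ℕ) :
    Subalgebra (ZPloc P) (G → ℂ) :=
  (Submodule.span (ZPloc P) (realCharacters G)).toSubalgebra
    (Submodule.subset_span one_mem_realCharacters) fun f f' hf hf' => by
      induction hf, hf' using Submodule.span_induction₂ with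
      | mem_mem f f' hf hf' => exact Submodule.subset_span (mul_mem_realCharacters hf hf')
      | zero_left => simp
      | zero_right => simp
      | add_left _ _ _ _ _ _ h h' => rw [add_mul]; exact add_mem h h'
      | add_right _ _ _ _ _ _ h h' => rw [mul_add]; exact add_mem h h'
      | smul_left r _ _ _ _ h => rw [smul_mul_assoc]; exact Submodule.smul_mem _ r h
      | smul_right r _ _ _ _ h => rw [mul_smul_comm]; exact Submodule.smul_mem _ r h

theorem mem_ROP_iff [Fintype G] {P : Set ℕ} {f : G → ℂ} :
    f ∈ ROP G P ↔ f ∈ ROPSubalgebra G P := by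
  rw [ROP_eq_span]
  rfl

theorem exists_natCast_mul_mem_int_of_mem_ZPloc {P : Set ℕ} {c : ℂ} (hc : c ∈ ZPloc P) :
    ∃ m : ℕ, m ≠ 0 ∧ (∀ p ∈ P, p.Prime → ¬ p ∣ m) ∧ ∃ k : ℤ, m * c = k := by
  induction hc using Subring.closure_induction with
  | mem c hc =>
    obtain ⟨q, hq, hqP, rfl⟩ := hc
    refine ⟨q, hq.ne_zero, fun p hp hpp hpq => hqP ?_, 1, ?_⟩
    · rwa [← (Nat.prime_dvd_prime_iff_eq hpp hq).1 hpq]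
    · simp [hq.ne_zero]
  | zero => exact ⟨1, one_ne_zero, fun p _ hp h => hp.one_lt.ne' (Nat.dvd_one.1 h), 0, by simp⟩
  | one => exact ⟨1, one_ne_zero, fun p _ hp h => hp.one_lt.ne' (Nat.dvd_one.1 h), 1, by simp⟩
  | add x y _ _ hx hy =>
    obtain ⟨m, hm, hmP, k, hk⟩ := hx
    obtain ⟨m', hm', hmP', k', hk'⟩ := hy
    refine ⟨m * m', mul_ne_zero hm hm', fun p hp hpp h =>
      (hpp.dvd_mul.1 h).elim (hmP p hp hpp) (hmP' p hp hpp), m' * k + m * k', ?_⟩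
    push_cast
    linear_combination m' * hk + m * hk'
  | neg x _ hx =>
    obtain ⟨m, hm, hmP, k, hk⟩ := hx
    refine ⟨m, hm, hmP, -k, ?_⟩
    push_cast
    linear_combination -hk
  | mul x y _ _ hx hy =>
    obtain ⟨m, hm, hmP, k, hk⟩ := hx
    obtain ⟨m', hm', hmP', k', hk'⟩ := hy
    refine ⟨m * m', mul_ne_zero hm hm', fun p hp hpp h =>
      (hpp.dvd_mul.1 h).elim (hmP p hp hpp) (hmP' p hp hpp), k * k', ?_⟩
    push_cast
    linear_combination m' * y * hk + k * hk'

theorem inv_natCast_mem_ZPloc {P : Set ℕ} {n : ℕ} (hn : ∀ p ∈ P, p.Prime → ¬ p ∣ n) :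
    (n : ℂ)⁻¹ ∈ ZPloc P := by
  induction n using Nat.recOnMul with
  | zero => simp
  | one => simp
  | prime q hq =>
    exact Subring.subset_closure ⟨q, hq, fun h => hn q h hq dvd_rfl, rfl⟩
  | mul a b ha hb =>
    rw [Nat.cast_mul, mul_inv]
    exact mul_mem (ha fun p hp hpp h => hn p hp hpp (h.mul_right b))
      (hb fun p hp hpp h => hn p hp hpp (h.mul_left a))

theorem exists_natCast_mul_mem_closure_of_mem_ROPSubalgebra {P : Set ℕ} {f : G → ℂ}
    (hf : f ∈ ROPSubalgebra G P) :
    ∃ m : ℕ, m ≠ 0 ∧ (∀ p ∈ P, p.Prime → ¬ p ∣ m) ∧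
      (m : G → ℂ) * f ∈ AddSubgroup.closure (realCharacters G) := by
  change f ∈ Submodule.span (ZPloc P) (realCharacters G) at hf
  induction hf using Submodule.span_induction with
  | mem f hf =>
    exact ⟨1, one_ne_zero, fun p _ hp h => hp.one_lt.ne' (Nat.dvd_one.1 h), by
      simpa using AddSubgroup.subset_closure hf⟩
  | zero =>
    exact ⟨1, one_ne_zero, fun p _ hp h => hp.one_lt.ne' (Nat.dvd_one.1 h), by
      simp [zero_mem]⟩
  | add x y _ _ hx hy =>
    obtain ⟨m, hm, hmP, h⟩ := hx
    obtain ⟨m', hm', hmP', h'⟩ := hy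
    refine ⟨m * m', mul_ne_zero hm hm', fun p hp hpp h =>
      (hpp.dvd_mul.1 h).elim (hmP p hp hpp) (hmP' p hp hpp), ?_⟩
    convert add_mem (nsmul_mem h m') (nsmul_mem h' m) using 1
    simp only [nsmul_eq_mul]
    push_cast
    ring
  | smul c x _ hx =>
    obtain ⟨m, hm, hmP, h⟩ := hx
    obtain ⟨m', hm', hmP', k, hk⟩ := exists_natCast_mul_mem_int_of_mem_ZPloc c.2
    refine ⟨m * m', mul_ne_zero hm hm', fun p hp hpp h =>
      (hpp.dvd_mul.1 h).elim (hmP p hp hpp) (hmP' p hp hpp), ?_⟩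
    convert zsmul_mem h k using 1
    funext g
    have : (c • x) g = (c : ℂ) * x g := rfl
    simp only [Pi.mul_apply, this, zsmul_eq_mul, Pi.intCast_apply, Pi.natCast_apply, ← hk]
    push_cast
    ring

end RealCharacters

section FrobeniusCongruence

theorem isIdempotentElem_average_pow {A : Type*} [Ring A] [Algebra ℂ A] {x : A} {n : ℕ}
    (hn : n ≠ 0) (hx : x ^ n = 1) :
    x * ((n : ℂ)⁻¹ • ∑ i ∈ Finset.range n, x ^ i) = (n : ℂ)⁻¹ • ∑ i ∈ Finset.range n, x ^ i ∧
      IsIdempotentElem ((n : ℂ)⁻¹ • ∑ i ∈ Finset.range n, x ^ i) := by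
  set e := (n : ℂ)⁻¹ • ∑ i ∈ Finset.range n, x ^ i with he
  have h : x * e = e := by
    have := mul_geom_sum x n
    rw [hx, sub_self, sub_mul, one_mul, sub_eq_zero] at this
    rw [he, mul_smul_comm, this]
  have hpow : ∀ i : ℕ, x ^ i * e = e := fun i => by
    induction i with
    | zero => simp
    | succ i ih => rw [pow_succ, mul_assoc, h, ih]
  refine ⟨h, ?_⟩
  change e * e = e
  conv_lhs => rw [he, smul_mul_assoc, Finset.sum_mul, Finset.sum_congr rfl fun i _ => hpow i]
  rw [Finset.sum_const, Finset.card_range, ← Nat.cast_smul_eq_nsmul ℂ, smul_smul,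
    inv_mul_cancel₀ (Nat.cast_ne_zero.2 hn), one_smul]

/-- The trace of the `m`-th power of an endomorphism of finite order `n` is the sum of the `m`-th
powers of the eigenvalues, which are `n`-th roots of unity. -/
theorem exists_trace_pow_eq_sum {V : Type*} [AddCommGroup V] [Module ℂ V] [Module.Finite ℂ V]
    {A : Module.End ℂ V} {n : ℕ} (hn : n ≠ 0) (hA : A ^ n = 1) :
    ∃ (r : ℕ → ℕ) (w : ℕ → ℂ), (∀ j, w j ^ n = 1) ∧
      ∀ m, LinearMap.trace ℂ V (A ^ m) = ∑ j ∈ Finset.range n, (w j) ^ m * r j := by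
  set ζ := Complex.exp (2 * Real.pi * Complex.I / n)
  have hζ : IsPrimitiveRoot ζ n := Complex.isPrimitiveRoot_exp n hn
  have hζ0 : ζ ≠ 0 := hζ.ne_zero hn
  have hn' : (n : ℂ) ≠ 0 := Nat.cast_ne_zero.2 hn
  set B : ℕ → Module.End ℂ V := fun j => (ζ⁻¹ ^ j) • A
  have hB : ∀ j, B j ^ n = 1 := fun j => by
    rw [smul_pow, hA, ← pow_mul, mul_comm, pow_mul, inv_pow, hζ.pow_eq_one]
    simp
  set e : ℕ → Module.End ℂ V := fun j => (n : ℂ)⁻¹ • ∑ i ∈ Finset.range n, B j ^ i with he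
  have hBe : ∀ j, B j * e j = e j := fun j => (isIdempotentElem_average_pow hn (hB j)).1
  have hAe : ∀ j, A * e j = ζ ^ j • e j := fun j => by
    conv_rhs => rw [← hBe j]
    rw [smul_mul_assoc, smul_smul, ← mul_pow, mul_inv_cancel₀ hζ0, one_pow, one_smul]
  have hApe : ∀ m j, A ^ m * e j = (ζ ^ j) ^ m • e j := fun m j => by
    induction m with
    | zero => simp
    | succ m ih => rw [pow_succ, mul_assoc, hAe, mul_smul_comm, ih, smul_smul, pow_succ']
  have hsum : ∑ j ∈ Finset.range n, e j = 1 := by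
    simp only [he, B, ← Finset.smul_sum, smul_pow]
    rw [Finset.sum_comm]
    simp only [← Finset.sum_smul]
    rw [Finset.sum_eq_single 0]
    · simp [← Nat.cast_smul_eq_nsmul ℂ, smul_smul, hn']
    · intro i hi hi0
      have hne : ζ⁻¹ ^ i ≠ 1 := by
        rw [inv_pow, Ne, inv_eq_one]
        exact hζ.pow_ne_one_of_pos_of_lt hi0 (Finset.mem_range.1 hi)
      have := mul_geom_sum (ζ⁻¹ ^ i) n
      rw [← pow_mul, mul_comm i n, pow_mul, inv_pow ζ n, hζ.pow_eq_one, inv_one, one_pow,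
        sub_self, mul_eq_zero] at this
      have h0 := this.resolve_left (sub_ne_zero.2 hne)
      simp only [← pow_mul, mul_comm _ i] at h0 ⊢
      rw [h0, zero_smul]
    · simp [hn]
  have htr : ∀ j, ∃ r : ℕ, LinearMap.trace ℂ V (e j) = r := fun j =>
    ⟨_, ((LinearMap.isProj_range_iff_isIdempotentElem (e j)).2
      (isIdempotentElem_average_pow hn (hB j)).2).trace⟩
  choose r hr using htr
  refine ⟨r, fun j => ζ ^ j, fun j => ?_, fun m => ?_⟩
  · rw [← pow_mul, mul_comm, pow_mul, hζ.pow_eq_one, one_pow]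
  · rw [← mul_one (A ^ m), ← hsum, Finset.mul_sum, map_sum]
    refine Finset.sum_congr rfl fun j _ => ?_
    rw [hApe, map_smul, hr, smul_eq_mul]

/-- The pairs `(x, y)` of algebraic integers such that `y` is congruent to `x ^ p` modulo `p`. -/
def frobeniusPairs (p : ℕ) (hp : p.Prime) :
    Subring (integralClosure ℤ ℂ × integralClosure ℤ ℂ) where
  carrier := {z | ∃ c, z.2 = z.1 ^ p + p * c}
  zero_mem' := ⟨0, by simp [hp.ne_zero]⟩
  one_mem' := ⟨0, by simp⟩
  add_mem' := by
    rintro ⟨x, y⟩ ⟨x', y'⟩ ⟨c, hc⟩ ⟨c', hc'⟩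
    obtain rfl : y = x ^ p + p * c := hc
    obtain rfl : y' = x' ^ p + p * c' := hc'
    obtain ⟨r, hr⟩ := exists_add_pow_prime_eq hp x x'
    refine ⟨c + c' - x * x' * r, ?_⟩
    simp only [Prod.mk_add_mk]
    linear_combination -hr
  mul_mem' := by
    rintro ⟨x, y⟩ ⟨x', y'⟩ ⟨c, hc⟩ ⟨c', hc'⟩
    obtain rfl : y = x ^ p + p * c := hc
    obtain rfl : y' = x' ^ p + p * c' := hc'
    refine ⟨c * x' ^ p + c' * x ^ p + p * c * c', ?_⟩
    simp only [Prod.mk_mul_mk]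
    ring
  neg_mem' := by
    rintro ⟨x, y⟩ ⟨c, hc⟩
    obtain rfl : y = x ^ p + p * c := hc
    obtain ⟨r, hr⟩ := exists_add_pow_prime_eq hp x (-x)
    rw [add_neg_cancel, zero_pow hp.ne_zero] at hr
    refine ⟨-c - x * x * r, ?_⟩
    simp only [Prod.neg_mk]
    linear_combination hr

/-- The inclusion of pairs of algebraic integers into pairs of complex numbers. -/
noncomputable def integerPairs :
    integralClosure ℤ ℂ × integralClosure ℤ ℂ →+* ℂ × ℂ :=
  RingHom.prodMap (algebraMap _ ℂ) (algebraMap _ ℂ)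

theorem pow_mem_map_frobeniusPairs {p : ℕ} (hp : p.Prime) {w : ℂ} {n : ℕ} (hn : n ≠ 0)
    (hw : w ^ n = 1) : (w, w ^ p) ∈ (frobeniusPairs p hp).map integerPairs := by
  have hint : IsIntegral ℤ w := IsIntegral.of_pow (Nat.pos_of_ne_zero hn) (hw ▸ isIntegral_one)
  exact ⟨(⟨w, hint⟩, ⟨w, hint⟩ ^ p), ⟨0, by simp⟩, rfl⟩

theorem trace_pow_mem_map_frobeniusPairs {p : ℕ} (hp : p.Prime) {V : Type*} [AddCommGroup V]
    [Module ℂ V] [Module.Finite ℂ V] {A : Module.End ℂ V} {n : ℕ} (hn : n ≠ 0) (hA : A ^ n = 1) :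
    (LinearMap.trace ℂ V A, LinearMap.trace ℂ V (A ^ p)) ∈
      (frobeniusPairs p hp).map integerPairs := by
  obtain ⟨r, w, hw, h⟩ := exists_trace_pow_eq_sum hn hA
  have h1 := h 1
  rw [pow_one] at h1
  have : (LinearMap.trace ℂ V A, LinearMap.trace ℂ V (A ^ p)) =
      ∑ j ∈ Finset.range n, (w j, w j ^ p) * (r j : ℂ × ℂ) := by
    rw [h1, h p]
    refine Prod.ext ?_ ?_ <;> simp [Prod.fst_sum, Prod.snd_sum]
  rw [this]
  exact sum_mem fun j _ => mul_mem (pow_mem_map_frobeniusPairs hp hn (hw j)) (natCast_mem _ _)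

variable {G : Type} [Group G]

theorem character_mem_map_frobeniusPairs [Finite G] {p : ℕ} (hp : p.Prime) (V : FDRep ℝ G)
    (g : G) : ((V.character g : ℂ), (V.character (g ^ p) : ℂ)) ∈
      (frobeniusPairs p hp).map integerPairs := by
  have key : ∀ k : ℕ, (V.character (g ^ k) : ℂ) =
      LinearMap.trace ℂ (TensorProduct ℝ ℂ V)
        ((LinearMap.baseChange ℂ (V.ρ g) : Module.End ℂ (TensorProduct ℝ ℂ V)) ^ k) := by
    intro k
    have hb := LinearMap.trace_baseChange (V.ρ g ^ k) ℂ
    rw [LinearMap.baseChange_pow] at hb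
    rw [hb, FDRep.character, map_pow]
    rfl
  have h1 := key 1
  rw [pow_one, pow_one] at h1
  rw [h1, key p]
  refine trace_pow_mem_map_frobeniusPairs hp (orderOf_pos g).ne' ?_
  rw [← LinearMap.baseChange_pow, ← map_pow, pow_orderOf_eq_one, map_one]
  exact LinearMap.baseChange_id

theorem mem_map_frobeniusPairs_of_mem_closure [Finite G] {p : ℕ} (hp : p.Prime) {F : G → ℂ}
    (hF : F ∈ AddSubgroup.closure (realCharacters G)) (g : G) :
    (F g, F (g ^ p)) ∈ (frobeniusPairs p hp).map integerPairs := by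
  induction hF using AddSubgroup.closure_induction with
  | mem F hF =>
    obtain ⟨V, rfl⟩ := hF
    exact character_mem_map_frobeniusPairs hp V g
  | zero => exact zero_mem _
  | add x y _ _ hx hy => exact add_mem hx hy
  | neg x _ hx => exact neg_mem hx

theorem dvd_of_isIntegral_of_natCast_eq_mul {p m : ℕ} (hp : p ≠ 0) {c : ℂ} (hc : IsIntegral ℤ c)
    (h : (m : ℂ) = p * c) : p ∣ m := by
  have hp' : (p : ℚ) ≠ 0 := Nat.cast_ne_zero.2 hp
  have hcq : c = algebraMap ℚ ℂ ((m : ℚ) / p) := by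
    simp only [eq_ratCast, Rat.cast_div, Rat.cast_natCast]
    rw [h, mul_div_cancel_left₀ _ (Nat.cast_ne_zero.2 hp)]
  rw [hcq, isIntegral_algebraMap_iff (algebraMap ℚ ℂ).injective] at hc
  obtain ⟨z, hz⟩ := IsIntegrallyClosed.isIntegral_iff.1 hc
  rw [eq_intCast, eq_div_iff hp'] at hz
  exact Int.natCast_dvd_natCast.1 ⟨z, by rw [mul_comm]; exact_mod_cast hz.symm⟩

theorem apply_pow_prime_eq_of_mem_closure [Finite G] {p m : ℕ} (hp : p.Prime) (hpm : ¬ p ∣ m)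
    {F : G → ℂ} (hF : F ∈ AddSubgroup.closure (realCharacters G))
    (hval : ∀ g, F g = 0 ∨ F g = m) (g : G) : F (g ^ p) = F g := by
  obtain ⟨⟨⟨x, hx⟩, ⟨y, hy⟩⟩, ⟨⟨c, hc⟩, h⟩, heq⟩ := mem_map_frobeniusPairs_of_mem_closure hp hF g
  obtain ⟨rfl, rfl⟩ : x = F g ∧ y = F (g ^ p) := Prod.mk.inj heq
  have h' : F (g ^ p) = F g ^ p + p * c := congrArg Subtype.val h
  rcases hval g with h0 | h0 <;> rcases hval (g ^ p) with h1 | h1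
  · rw [h0, h1]
  · rw [h0, h1, zero_pow hp.ne_zero, zero_add] at h'
    exact absurd (dvd_of_isIntegral_of_natCast_eq_mul hp.ne_zero hc h') hpm
  · rw [h0, h1] at h'
    have h2 : ((m ^ p : ℕ) : ℂ) = p * (-c) := by
      push_cast
      linear_combination -h'
    exact absurd (hp.dvd_of_dvd_pow
      (dvd_of_isIntegral_of_natCast_eq_mul hp.ne_zero (IsIntegral.neg hc) h2)) hpm
  · rw [h0, h1]

end FrobeniusCongruence

section PrimePart

variable {G : Type} [Group G]

/-- The subgroup of elements of `⟨g⟩` whose order is not divisible by any prime in `P`. -/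
def primePartSubgroup (P : Set ℕ) (g : G) : Subgroup G where
  carrier := {z | z ∈ Subgroup.zpowers g ∧ ∀ p : ℕ, p.Prime → p ∣ orderOf z → p ∉ P}
  one_mem' := ⟨one_mem _, fun p hp h => absurd (Nat.dvd_one.1 (orderOf_one (G := G) ▸ h))
    hp.one_lt.ne'⟩
  mul_mem' := by
    rintro a b ⟨ha, haP⟩ ⟨hb, hbP⟩
    refine ⟨mul_mem ha hb, fun p hp h => ?_⟩
    have hcomm : Commute a b := by
      obtain ⟨i, rfl⟩ := ha
      obtain ⟨j, rfl⟩ := hb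
      exact ((Commute.refl g).zpow_left i).zpow_right j
    rcases hp.dvd_mul.1 (h.trans hcomm.orderOf_mul_dvd_mul_orderOf) with h | h
    · exact haP p hp h
    · exact hbP p hp h
  inv_mem' := by
    rintro a ⟨ha, haP⟩
    exact ⟨inv_mem ha, fun p hp h => haP p hp (by rwa [orderOf_inv] at h)⟩

theorem mem_primePartSubgroup {P : Set ℕ} {g z : G} :
    z ∈ primePartSubgroup P g ↔
      z ∈ Subgroup.zpowers g ∧ ∀ p : ℕ, p.Prime → p ∣ orderOf z → p ∉ P :=
  Iff.rfl

theorem map_conj_primePartSubgroup (P : Set ℕ) (c g : G) :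
    (primePartSubgroup P g).map (MulAut.conj c).toMonoidHom =
      primePartSubgroup P (c * g * c⁻¹) := by
  have hle : ∀ c g : G, (primePartSubgroup P g).map (MulAut.conj c).toMonoidHom ≤
      primePartSubgroup P (c * g * c⁻¹) := by
    rintro c g _ ⟨z, ⟨⟨k, rfl⟩, hzP⟩, rfl⟩
    refine ⟨⟨k, ?_⟩, fun p hp h => hzP p hp ?_⟩
    · simp [conj_zpow]
    · have := orderOf_injective (MulAut.conj c).toMonoidHom (MulAut.conj c).injective (g ^ k)
      exact this ▸ h
  refine le_antisymm (hle c g) fun z hz => ?_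
  have h := hle c⁻¹ (c * g * c⁻¹) ⟨z, hz, rfl⟩
  refine ⟨c⁻¹ * z * c, ?_, ?_⟩
  · simpa [mul_assoc] using h
  · simp [mul_assoc]

theorem exists_mul_eq_and_prime_dvd_imp (P : Set ℕ) {n : ℕ} (hn : n ≠ 0) :
    ∃ u v, u * v = n ∧ (∀ p : ℕ, p.Prime → p ∣ u → p ∈ P) ∧
      ∀ p : ℕ, p.Prime → p ∣ v → p ∉ P := by
  have h1 : ∀ p : ℕ, p.Prime → ¬ p ∣ 1 := fun p hp h => hp.one_lt.ne' (Nat.dvd_one.1 h)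
  induction n using Nat.recOnMul with
  | zero => exact absurd rfl hn
  | one => exact ⟨1, 1, rfl, fun p hp h => absurd h (h1 p hp), fun p hp h => absurd h (h1 p hp)⟩
  | prime q hq =>
    by_cases hqP : q ∈ P
    · refine ⟨q, 1, mul_one q, fun p hp h => ?_, fun p hp h => absurd h (h1 p hp)⟩
      rwa [(Nat.prime_dvd_prime_iff_eq hp hq).1 h]
    · refine ⟨1, q, one_mul q, fun p hp h => absurd h (h1 p hp), fun p hp h => ?_⟩
      rwa [(Nat.prime_dvd_prime_iff_eq hp hq).1 h]
  | mul a b ha hb =>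
    obtain ⟨u, v, huv, hu, hv⟩ := ha (left_ne_zero_of_mul hn)
    obtain ⟨u', v', huv', hu', hv'⟩ := hb (right_ne_zero_of_mul hn)
    refine ⟨u * u', v * v', by rw [mul_mul_mul_comm, huv, huv'], fun p hp h => ?_,
      fun p hp h => ?_⟩
    · exact (hp.dvd_mul.1 h).elim (hu p hp) (hu' p hp)
    · exact (hp.dvd_mul.1 h).elim (hv p hp) (hv' p hp)

theorem exists_isPPrimePart [Finite G] (P : Set ℕ) (g : G) : ∃ b, IsPPrimePart P g b := by
  obtain ⟨u, v, huv, hu, hv⟩ := exists_mul_eq_and_prime_dvd_imp P (orderOf_pos g).ne'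
  have hcop : Nat.Coprime u v :=
    Nat.coprime_of_dvd fun p hp h h' => hv p hp h' (hu p hp h)
  have hbez : (1 : ℤ) = u * u.gcdA v + v * u.gcdB v := by
    have := Nat.gcd_eq_gcd_ab u v
    rwa [hcop.gcd_eq_one, Nat.cast_one] at this
  have hg : g ^ ((u : ℤ) * v) = 1 := by
    rw [← Nat.cast_mul, huv, zpow_natCast, pow_orderOf_eq_one]
  refine ⟨g ^ ((u : ℤ) * u.gcdA v), ⟨_, rfl⟩, fun p hp h => hv p hp (h.trans ?_),
    fun p hp h => hu p hp (h.trans ?_)⟩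
  · refine orderOf_dvd_of_pow_eq_one ?_
    rw [← zpow_natCast, ← zpow_mul, mul_right_comm, zpow_mul, hg, one_zpow]
  · have : g * (g ^ ((u : ℤ) * u.gcdA v))⁻¹ = g ^ ((v : ℤ) * u.gcdB v) := by
      rw [← zpow_neg, ← zpow_one_add]
      congr 1
      linear_combination hbez
    refine orderOf_dvd_of_pow_eq_one ?_
    rw [this, ← zpow_natCast, ← zpow_mul, mul_comm, ← mul_assoc, zpow_mul, hg, one_zpow]

theorem IsPPrimePart.zpowers_eq [Finite G] {P : Set ℕ} {g b : G} (h : IsPPrimePart P g b) :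
    Subgroup.zpowers b = primePartSubgroup P g := by
  obtain ⟨hb, hbP, haP⟩ := h
  refine le_antisymm (Subgroup.zpowers_le.2 ⟨hb, hbP⟩) ?_
  rintro z hz
  obtain ⟨⟨k, rfl⟩, -⟩ := id hz
  have hcomm : Commute g b := by
    obtain ⟨i, rfl⟩ := hb
    exact (Commute.refl g).zpow_right i
  have hak : (g * b⁻¹) ^ k = g ^ k * (b ^ k)⁻¹ := by
    rw [hcomm.inv_right.mul_zpow, inv_zpow]
  have hmem : (g * b⁻¹) ^ k ∈ primePartSubgroup P g := by
    rw [hak]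
    exact mul_mem hz (inv_mem (zpow_mem (⟨hb, hbP⟩ : b ∈ primePartSubgroup P g) k))
  have hone : (g * b⁻¹) ^ k = 1 := by
    rw [← orderOf_eq_one_iff]
    by_contra hne
    obtain ⟨p, hp, hpd⟩ := Nat.exists_prime_and_dvd hne
    exact hmem.2 p hp hpd (haP p hp (hpd.trans (orderOf_dvd_of_mem_zpowers ⟨k, rfl⟩)))
  rw [hak, mul_inv_eq_one] at hone
  exact ⟨k, hone.symm⟩

theorem SubConj.symm {C D : Subgroup G} (h : SubConj C D) : SubConj D C := by
  obtain ⟨c, rfl⟩ := h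
  refine ⟨c⁻¹, ?_⟩
  ext z
  simp [Subgroup.mem_map, mul_assoc]

theorem SubConj.trans {C D E : Subgroup G} (h : SubConj C D) (h' : SubConj D E) :
    SubConj C E := by
  obtain ⟨c, rfl⟩ := h
  obtain ⟨d, rfl⟩ := h'
  refine ⟨d * c, ?_⟩
  rw [Subgroup.map_map]
  congr 1
  ext z
  simp [mul_assoc]

theorem eIdem_apply [Finite G] (P : Set ℕ) (C : Subgroup G) (g : G) :
    eIdem P C g = if SubConj (primePartSubgroup P g) C then 1 else 0 := by
  refine if_congr ⟨?_, fun h => ?_⟩ rfl rfl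
  · rintro ⟨b, hb, h⟩
    rwa [← hb.zpowers_eq]
  · obtain ⟨b, hb⟩ := exists_isPPrimePart P g
    exact ⟨b, hb, by rwa [hb.zpowers_eq]⟩

theorem subConj_primePartSubgroup_of_singleton [Finite G] {P : Set ℕ} {p : ℕ}
    (hp : p ∈ P ∨ ¬ p ∣ Nat.card G) {x y : G}
    (h : SubConj (primePartSubgroup {p} x) (primePartSubgroup {p} y)) :
    SubConj (primePartSubgroup P x) (primePartSubgroup P y) := by
  have hmem : ∀ g z : G, z ∈ primePartSubgroup P g ↔ z ∈ primePartSubgroup {p} g ∧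
      ∀ q : ℕ, q.Prime → q ∣ orderOf z → q ∉ P := by
    refine fun g z => ⟨fun hz => ⟨⟨hz.1, ?_⟩, hz.2⟩, fun hz => ⟨hz.1.1, hz.2⟩⟩
    rintro q hq hqz rfl
    rcases hp with hp | hp
    · exact hz.2 q hq hqz hp
    · exact hp (hqz.trans (orderOf_dvd_natCard z))
  have hle : ∀ c x y : G, primePartSubgroup {p} (c * x * c⁻¹) ≤ primePartSubgroup {p} y →
      primePartSubgroup P (c * x * c⁻¹) ≤ primePartSubgroup P y := by
    intro c x y hle z hz
    rw [hmem] at hz ⊢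
    exact ⟨hle hz.1, hz.2⟩
  obtain ⟨c, hc⟩ := h
  rw [map_conj_primePartSubgroup] at hc
  refine ⟨c, ?_⟩
  rw [map_conj_primePartSubgroup]
  refine le_antisymm (hle c x y hc.le) ?_
  simpa using hle 1 y (c * x * c⁻¹) (by simpa using hc.ge)

theorem primePartSubgroup_eq_zpowers_of_cyclicPPerfect {P : Set ℕ} {g : G}
    (h : ∀ p : ℕ, p.Prime → p ∈ P → ¬ p ∣ Nat.card (Subgroup.zpowers g)) :
    primePartSubgroup P g = Subgroup.zpowers g := by
  refine le_antisymm (fun z hz => hz.1) (Subgroup.zpowers_le.2 ⟨Subgroup.mem_zpowers g, ?_⟩)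
  intro p hp hpg hpP
  exact h p hp hpP (by rwa [Nat.card_zpowers])

theorem cyclicPPerfect_primePartSubgroup [Finite G] (P : Set ℕ) (g : G) :
    CyclicPPerfect P (primePartSubgroup P g) := by
  obtain ⟨b, hb⟩ := exists_isPPrimePart P g
  rw [← hb.zpowers_eq]
  exact ⟨inferInstance, fun p hp hpP h => hb.2.1 p hp (by rwa [Nat.card_zpowers] at h) hpP⟩

end PrimePart

section FixedPoints

variable {G : Type} [Group G]

theorem mem_fixedBy_quotient_iff (H : Subgroup G) (x a : G) :
    (a : G ⧸ H) ∈ MulAction.fixedBy (G ⧸ H) x ↔ a⁻¹ * x * a ∈ H := by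
  rw [MulAction.mem_fixedBy, eq_comm, MulAction.Quotient.smul_mk, QuotientGroup.eq, smul_eq_mul,
    mul_assoc]

theorem card_fixedBy_eq_of_forall_mem {N : Subgroup G} (H : Subgroup N) (x : N)
    (h : ∀ a : G, a⁻¹ * x * a ∈ H.map N.subtype → a ∈ N) :
    Nat.card (MulAction.fixedBy (N ⧸ H) x) =
      Nat.card (MulAction.fixedBy (G ⧸ H.map N.subtype) (x : G)) := by
  have hiff : ∀ n : N, (n : G) ∈ H.map N.subtype ↔ n ∈ H := fun n =>
    ⟨fun ⟨m, hm, hmn⟩ => Subtype.ext hmn ▸ hm, fun hn => ⟨n, hn, rfl⟩⟩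
  let φ : N ⧸ H → G ⧸ H.map N.subtype :=
    Quotient.map' (fun n => (n : G)) fun a b hab => by
      rw [QuotientGroup.leftRel_apply] at hab ⊢
      exact (hiff (a⁻¹ * b)).2 hab
  have hφ : ∀ n : N, φ (n : N ⧸ H) = ((n : G) : G ⧸ H.map N.subtype) := fun _ => rfl
  have hinj : Function.Injective φ := by
    intro a b hab
    induction a using QuotientGroup.induction_on with | _ a
    induction b using QuotientGroup.induction_on with | _ b
    rw [hφ, hφ, QuotientGroup.eq] at hab
    exact QuotientGroup.eq.2 ((hiff (a⁻¹ * b)).1 hab)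
  have himage : φ '' MulAction.fixedBy (N ⧸ H) x =
      MulAction.fixedBy (G ⧸ H.map N.subtype) (x : G) := by
    ext q
    constructor
    · rintro ⟨n, hn, rfl⟩
      induction n using QuotientGroup.induction_on with | _ n
      rw [mem_fixedBy_quotient_iff] at hn
      rw [hφ, mem_fixedBy_quotient_iff]
      exact (hiff (n⁻¹ * x * n)).2 hn
    · intro hq
      induction q using QuotientGroup.induction_on with | _ a
      rw [mem_fixedBy_quotient_iff] at hq
      refine ⟨((⟨a, h a hq⟩ : N) : N ⧸ H), ?_, rfl⟩
      rw [mem_fixedBy_quotient_iff]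
      exact (hiff ((⟨a, h a hq⟩ : N)⁻¹ * x * ⟨a, h a hq⟩)).1 hq
  rw [← himage, Nat.card_image_of_injective hinj]

theorem card_modEq_card_fixedBy {X : Type} [MulAction G X] [Finite X] {p n : ℕ} (hp : p.Prime)
    {x : G} (hx : ∀ q : X, x ^ p ^ n • q = q) :
    Nat.card X ≡ Nat.card (MulAction.fixedBy X x) [MOD p] := by
  have := Fintype.ofFinite X
  have := Fact.mk hp
  have h := Equiv.Perm.card_fixedPoints_modEq (p := p) (n := n)
    (f := MulAction.toEndHom (M := G) (α := X) x) (by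
      rw [← map_pow]
      exact funext hx)
  rw [← Nat.card_eq_fintype_card, ← Nat.card_eq_fintype_card] at h
  exact h

/-- A subgroup of the normalizer of `D`, containing `D`, whose image modulo `D` is a Sylow
`p`-subgroup. -/
theorem exists_subgroup_normalizer_not_dvd_index [Finite G] {p : ℕ} (hp : p.Prime)
    (D : Subgroup G) :
    ∃ H : Subgroup (Subgroup.normalizer (D : Set G)),
      D.subgroupOf (Subgroup.normalizer (D : Set G)) ≤ H ∧ ¬ p ∣ H.index ∧
        ∀ z ∈ H, ¬ p ∣ orderOf z → (z : G) ∈ D := by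
  have := Fact.mk hp
  set N := Subgroup.normalizer (D : Set G)
  have hnormal : (D.subgroupOf N).Normal := Subgroup.normal_in_normalizer
  obtain ⟨Q⟩ : Nonempty (Sylow p (N ⧸ D.subgroupOf N)) := inferInstance
  refine ⟨(Q : Subgroup (N ⧸ D.subgroupOf N)).comap (QuotientGroup.mk' (D.subgroupOf N)),
    ?_, ?_, ?_⟩
  · intro z hz
    rw [Subgroup.mem_comap, QuotientGroup.mk'_apply, (QuotientGroup.eq_one_iff z).2 hz]
    exact one_mem _
  · rw [Subgroup.index_comap_of_surjective _ (QuotientGroup.mk'_surjective _)]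
    exact Q.not_dvd_index
  · intro z hz hpz
    rw [Subgroup.mem_comap] at hz
    have hz1 : QuotientGroup.mk' (D.subgroupOf N) z = 1 := by
      obtain ⟨k, hk⟩ := (IsPGroup.iff_orderOf.1 Q.2) ⟨_, hz⟩
      rw [Subgroup.orderOf_mk] at hk
      have hdvd := orderOf_map_dvd (QuotientGroup.mk' (D.subgroupOf N)) z
      rw [hk] at hdvd
      rcases Nat.eq_zero_or_pos k with rfl | hk0
      · rwa [pow_zero, orderOf_eq_one_iff] at hk
      · exact absurd ((dvd_pow_self p hk0.ne').trans hdvd) hpz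
    exact Subgroup.mem_subgroupOf.1 ((QuotientGroup.eq_one_iff z).1 hz1)

theorem mem_primePartSubgroup_singleton {p : ℕ} (hp : p.Prime) {g z : G} :
    z ∈ primePartSubgroup {p} g ↔ z ∈ Subgroup.zpowers g ∧ ¬ p ∣ orderOf z := by
  rw [mem_primePartSubgroup]
  refine and_congr_right fun _ => ⟨fun h h' => h p hp h' rfl, ?_⟩
  rintro h q _ hq rfl
  exact h hq

theorem exists_subgroup_not_dvd_card_fixedBy [Finite G] {p : ℕ} (hp : p.Prime) (x : G) :
    ∃ H : Subgroup G, ¬ p ∣ Nat.card (MulAction.fixedBy (G ⧸ H) x) ∧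
      ∀ y, ¬ p ∣ Nat.card (MulAction.fixedBy (G ⧸ H) y) →
        ∃ c, primePartSubgroup {p} (c * y * c⁻¹) ≤ primePartSubgroup {p} x := by
  set D := primePartSubgroup {p} x with hD
  set N := Subgroup.normalizer (D : Set G) with hN
  obtain ⟨H, hDH, hindex, hH⟩ := exists_subgroup_normalizer_not_dvd_index hp D
  have hle : ∀ y ∈ H.map N.subtype, primePartSubgroup {p} y ≤ D := by
    intro y hy z hz
    rw [mem_primePartSubgroup_singleton hp] at hz
    obtain ⟨w, hw, rfl⟩ := Subgroup.zpowers_le.2 hy hz.1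
    exact hH w hw (by
      have := hz.2
      rwa [Subgroup.coe_subtype, Subgroup.orderOf_coe] at this)
  have hcard : ∀ a : G, Nat.card (primePartSubgroup {p} (a * x * a⁻¹)) = Nat.card D := fun a => by
    rw [← map_conj_primePartSubgroup]
    exact Subgroup.card_map_of_injective (MulAut.conj a).injective
  have hfix : ∀ a : G, a⁻¹ * x * a ∈ H.map N.subtype → a ∈ N := by
    intro a ha
    have h1 : D.map (MulAut.conj a⁻¹).toMonoidHom = D := by
      rw [hD, map_conj_primePartSubgroup]
      refine Subgroup.eq_of_le_of_card_ge (hle _ (by simpa using ha)) ?_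
      rw [hcard]
    have h2 : a⁻¹ ∈ N := by
      rw [hN, Subgroup.mem_normalizer_iff_conj_image_eq]
      exact congrArg (SetLike.coe : Subgroup G → Set G) h1
    simpa using inv_mem h2
  have hxN : x ∈ N := by
    rw [hN, Subgroup.mem_normalizer_iff_conj_image_eq]
    have := map_conj_primePartSubgroup {p} x x
    rw [mul_inv_cancel_right] at this
    exact congrArg (SetLike.coe : Subgroup G → Set G) this
  refine ⟨H.map N.subtype, ?_, fun y hy => ?_⟩
  · rw [← card_fixedBy_eq_of_forall_mem H ⟨x, hxN⟩ hfix]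
    obtain ⟨n, m, hm, hnm⟩ := Nat.exists_eq_pow_mul_and_not_dvd (orderOf_pos x).ne' p hp.ne_one
    have hxD : x ^ p ^ n ∈ D := by
      refine (mem_primePartSubgroup_singleton hp).2 ⟨Subgroup.npow_mem_zpowers x _, fun h => hm ?_⟩
      refine h.trans (orderOf_dvd_of_pow_eq_one ?_)
      rw [← pow_mul, ← hnm, pow_orderOf_eq_one]
    have hact : ∀ q : N ⧸ H, (⟨x, hxN⟩ : N) ^ p ^ n • q = q := by
      intro q
      induction q using QuotientGroup.induction_on with | _ a
      rw [← MulAction.mem_fixedBy, mem_fixedBy_quotient_iff]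
      refine hDH (Subgroup.mem_subgroupOf.2 ?_)
      simpa using (Subgroup.mem_normalizer_iff.1 (inv_mem a.2) _).1 hxD
    have hmod := card_modEq_card_fixedBy hp hact
    intro h
    exact hindex ((hmod.dvd_iff dvd_rfl).2 h)
  · obtain ⟨q, hq⟩ : (MulAction.fixedBy (G ⧸ H.map N.subtype) y).Nonempty := by
      by_contra hne
      rw [Set.not_nonempty_iff_eq_empty] at hne
      simp [hne] at hy
    induction q using QuotientGroup.induction_on with | _ a
    rw [mem_fixedBy_quotient_iff] at hq
    exact ⟨a⁻¹, hle _ (by simpa using hq)⟩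

theorem exists_subgroup_card_fixedBy_not_modEq [Finite G] {p : ℕ} (hp : p.Prime) {x y : G}
    (h : ¬ SubConj (primePartSubgroup {p} x) (primePartSubgroup {p} y)) :
    ∃ H : Subgroup G, ¬ (p : ℤ) ∣ (Nat.card (MulAction.fixedBy (G ⧸ H) x) : ℤ) -
      Nat.card (MulAction.fixedBy (G ⧸ H) y) := by
  by_contra! hall
  have hdvd : ∀ H : Subgroup G, p ∣ Nat.card (MulAction.fixedBy (G ⧸ H) x) ↔
      p ∣ Nat.card (MulAction.fixedBy (G ⧸ H) y) := fun H => by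
    rw [← Int.natCast_dvd_natCast, ← Int.natCast_dvd_natCast]
    exact dvd_iff_dvd_of_dvd_sub (hall H)
  obtain ⟨H, hHx, hH⟩ := exists_subgroup_not_dvd_card_fixedBy hp x
  obtain ⟨K, hKy, hK⟩ := exists_subgroup_not_dvd_card_fixedBy hp y
  obtain ⟨c, hc⟩ := hH y (by rwa [← hdvd])
  obtain ⟨d, hd⟩ := hK x (by rwa [hdvd])
  have hcard : ∀ a z : G, Nat.card (primePartSubgroup {p} (a * z * a⁻¹)) =
      Nat.card (primePartSubgroup {p} z) := fun a z => by
    rw [← map_conj_primePartSubgroup]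
    exact Subgroup.card_map_of_injective (MulAut.conj a).injective
  refine h ⟨d, ?_⟩
  rw [map_conj_primePartSubgroup]
  refine Subgroup.eq_of_le_of_card_ge hd ?_
  rw [hcard, ← hcard c y]
  exact Subgroup.card_le_of_le hc

end FixedPoints

section Main

variable {G : Type} [Group G]

/-- A `{0, 1}`-valued function whose values are separated modulo `p` by a ring of integer-valued
functions lies in that ring up to a factor prime to `p`. -/
theorem exists_not_dvd_mul_mem_of_separates {X : Type*} [Fintype X] (R : Subring (X → ℤ)) {p : ℕ}
    (hp : p.Prime) {e : X → ℤ} (he : ∀ x, e x = 0 ∨ e x = 1)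
    (hsep : ∀ x y, e x = 1 → e y = 0 → ∃ t ∈ R, ¬ (p : ℤ) ∣ t x - t y) :
    ∃ l : ℤ, ¬ (p : ℤ) ∣ l ∧ (l : X → ℤ) * e ∈ R := by
  have hp' : Prime (p : ℤ) := Nat.prime_iff_prime_int.1 hp
  have hu : ∀ x, e x = 1 → ∃ u ∈ R, ¬ (p : ℤ) ∣ u x ∧ ∀ y, e y = 0 → u y = 0 := by
    intro x hx
    choose! t ht htp using fun y hy => hsep x y hx hy
    refine ⟨∏ y with e y = 0, (t y - ((t y y : ℤ) : X → ℤ)), prod_mem fun y hy =>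
      sub_mem (ht y (Finset.mem_filter.1 hy).2) (intCast_mem _ _), ?_, fun y hy => ?_⟩
    · rw [Finset.prod_apply, hp'.dvd_finsetProd_iff]
      rintro ⟨y, hy, h⟩
      exact htp y (Finset.mem_filter.1 hy).2 h
    · rw [Finset.prod_apply]
      exact Finset.prod_eq_zero (Finset.mem_filter.2 ⟨Finset.mem_univ y, hy⟩) (by simp)
  choose! u hu hup hu0 using hu
  have hmem : ∏ x with e x = 1, (((u x x : ℤ) : X → ℤ) - u x) ∈ R := prod_mem fun x hx =>
    sub_mem (intCast_mem _ _) (hu x (Finset.mem_filter.1 hx).2)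
  refine ⟨∏ x with e x = 1, u x x, ?_, ?_⟩
  · rw [hp'.dvd_finsetProd_iff]
    rintro ⟨x, hx, h⟩
    exact hup x (Finset.mem_filter.1 hx).2 h
  · convert sub_mem (intCast_mem R (∏ x with e x = 1, u x x)) hmem using 1
    funext z
    rw [Pi.mul_apply, Pi.sub_apply, Finset.prod_apply, Pi.intCast_apply]
    rcases he z with hz | hz
    · rw [hz, mul_zero, eq_comm, sub_eq_zero, Int.cast_id]
      refine Finset.prod_congr rfl fun x hx => ?_
      simp [hu0 x (Finset.mem_filter.1 hx).2 z hz]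
    · have h0 : ∏ x with e x = 1, (((u x x : ℤ) : X → ℤ) - u x) z = 0 :=
        Finset.prod_eq_zero (Finset.mem_filter.2 ⟨Finset.mem_univ z, hz⟩) (sub_self (u z z))
      rw [hz, h0, sub_zero, mul_one]

theorem exists_not_dvd_mul_eIdem_mem [Fintype G] {P : Set ℕ} (C : Subgroup G) {p : ℕ}
    (hp : p.Prime) (hpP : p ∈ P ∨ ¬ p ∣ Nat.card G) :
    ∃ l : ℤ, ¬ (p : ℤ) ∣ l ∧ (l : G → ℂ) * eIdem P C ∈ ROPSubalgebra G P := by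
  set e : G → ℤ := fun g => if SubConj (primePartSubgroup P g) C then 1 else 0 with he
  set ι : (G → ℤ) →+* (G → ℂ) := RingHom.pi fun g =>
    (Int.castRingHom ℂ).comp (Pi.evalRingHom _ g)
  have hιe : ι e = eIdem P C := by
    funext g
    change ((e g : ℤ) : ℂ) = _
    rw [eIdem_apply, he]
    push_cast
    rfl
  obtain ⟨l, hl, hle⟩ := exists_not_dvd_mul_mem_of_separates
    ((ROPSubalgebra G P).toSubring.comap ι) hp (e := e)
    (fun x => (ite_eq_or_eq _ _ _).symm) (by
      intro x y hx hy
      have hxC : SubConj (primePartSubgroup P x) C := by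
        by_contra h
        simp [he, h] at hx
      have hyC : ¬ SubConj (primePartSubgroup P y) C := fun h => by
        simp [he, h] at hy
      obtain ⟨H, hH⟩ := exists_subgroup_card_fixedBy_not_modEq hp (x := x) (y := y) fun h =>
        hyC ((subConj_primePartSubgroup_of_singleton hpP h).symm.trans hxC)
      refine ⟨fun g => Nat.card (MulAction.fixedBy (G ⧸ H) g), ?_, hH⟩
      change ι _ ∈ Submodule.span (ZPloc P) (realCharacters G)
      refine Submodule.subset_span ?_
      convert card_fixedBy_mem_realCharacters (G := G) (G ⧸ H) using 1
      funext g
      simp [ι])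
  refine ⟨l, hl, ?_⟩
  have : ι ((l : G → ℤ) * e) ∈ ROPSubalgebra G P := hle
  rwa [map_mul, map_intCast, hιe] at this

theorem eIdem_mem_ROPSubalgebra [Fintype G] (P : Set ℕ) (C : Subgroup G) :
    eIdem P C ∈ ROPSubalgebra G P := by
  let I : Ideal ℤ :=
    { carrier := {l | (l : G → ℂ) * eIdem P C ∈ ROPSubalgebra G P}
      zero_mem' := by simp [zero_mem]
      add_mem' := fun {a b} ha hb => by
        change ((a + b : ℤ) : G → ℂ) * eIdem P C ∈ ROPSubalgebra G P
        rw [Int.cast_add, add_mul]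
        exact add_mem ha hb
      smul_mem' := fun c l hl => by
        change ((c * l : ℤ) : G → ℂ) * eIdem P C ∈ ROPSubalgebra G P
        rw [Int.cast_mul, mul_assoc]
        exact mul_mem (intCast_mem _ c) hl }
  obtain ⟨k, hk⟩ := (IsPrincipalIdealRing.principal I).principal
  set n := k.natAbs
  have hnI : ∀ l ∈ I, (n : ℤ) ∣ l := fun l hl => by
    rw [hk] at hl
    exact Int.natAbs_dvd.2 (Ideal.mem_span_singleton.1 hl)
  have hn : (n : ℤ) ∈ I := by
    rw [hk]
    exact Ideal.mem_span_singleton.2 (Int.dvd_natAbs.2 dvd_rfl)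
  have hnp : ∀ p : ℕ, p.Prime → (p ∈ P ∨ ¬ p ∣ Nat.card G) → ¬ p ∣ n := by
    intro p hp hpP hpn
    obtain ⟨l, hl, hle⟩ := exists_not_dvd_mul_eIdem_mem C hp hpP
    exact hl ((Int.natCast_dvd_natCast.2 hpn).trans (hnI l hle))
  have hn0 : n ≠ 0 := by
    rintro h
    obtain ⟨p, hpG, hp⟩ := Nat.exists_infinite_primes (Nat.card G + 1)
    refine hnp p hp (Or.inr fun h => ?_) (h ▸ dvd_zero p)
    exact absurd (Nat.le_of_dvd Nat.card_pos h) (by lia)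
  have hinv : (n : ℂ)⁻¹ ∈ ZPloc P :=
    inv_natCast_mem_ZPloc fun p hpP hp => hnp p hp (Or.inl hpP)
  have hmem := (ROPSubalgebra G P).smul_mem hn (⟨_, hinv⟩ : ZPloc P)
  convert hmem using 1
  funext g
  change _ = (n : ℂ)⁻¹ * (((n : ℤ) : ℂ) * eIdem P C g)
  rw [Int.cast_natCast, inv_mul_cancel_left₀ (Nat.cast_ne_zero.2 hn0)]

theorem apply_conj_of_mem_closure {F : G → ℂ}
    (hF : F ∈ AddSubgroup.closure (realCharacters G)) (c g : G) : F (c * g * c⁻¹) = F g := by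
  induction hF using AddSubgroup.closure_induction with
  | mem F hF =>
    obtain ⟨V, rfl⟩ := hF
    simp only [FDRep.char_conj]
  | zero => rfl
  | add x y _ _ hx hy => rw [Pi.add_apply, Pi.add_apply, hx, hy]
  | neg x _ hx => rw [Pi.neg_apply, Pi.neg_apply, hx]

/-- An idempotent of `RO_P(G)` takes the same value at elements whose `P'`-parts generate
conjugate subgroups. -/
theorem apply_eq_of_subConj_of_idempotent [Finite G] {P : Set ℕ} {f : G → ℂ}
    (hf : f ∈ ROPSubalgebra G P) (hidem : f * f = f) {x y : G}
    (h : SubConj (primePartSubgroup P x) (primePartSubgroup P y)) : f x = f y := by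
  obtain ⟨m, hm, hmP, hF⟩ := exists_natCast_mul_mem_closure_of_mem_ROPSubalgebra hf
  have hval : ∀ g, ((m : G → ℂ) * f) g = 0 ∨ ((m : G → ℂ) * f) g = m := fun g => by
    rcases IsIdempotentElem.iff_eq_zero_or_one.1 (congrFun hidem g : f g * f g = f g) with h | h
    · left; simp [h]
    · right; simp [h]
  have hcancel : ∀ g g', ((m : G → ℂ) * f) g = ((m : G → ℂ) * f) g' → f g = f g' :=
    fun g g' h => mul_left_cancel₀ (Nat.cast_ne_zero.2 hm) h
  have hconj : ∀ c g, f (c * g * c⁻¹) = f g := fun c g =>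
    hcancel _ _ (apply_conj_of_mem_closure hF c g)
  have hprime : ∀ p : ℕ, p.Prime → ¬ p ∣ m → ∀ g, f (g ^ p) = f g := fun p hp hpm g =>
    hcancel _ _ (apply_pow_prime_eq_of_mem_closure hp hpm hF hval g)
  have hpow : ∀ u : ℕ, u ≠ 0 → (∀ p : ℕ, p.Prime → p ∣ u → p ∈ P) → ∀ g, f (g ^ u) = f g := by
    intro u
    induction u using Nat.recOnMul with
    | zero => exact fun h => absurd rfl h
    | one => simp
    | prime q hq => exact fun _ h => hprime q hq (hmP q (h q hq dvd_rfl) hq)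
    | mul a b ha hb =>
      intro hab h g
      rw [pow_mul, hb (right_ne_zero_of_mul hab) fun p hp hpb => h p hp (hpb.mul_left a),
        ha (left_ne_zero_of_mul hab) fun p hp hpa => h p hp (hpa.mul_right b)]
  have hpart : ∀ g b, IsPPrimePart P g b → f g = f b := by
    intro g b hb
    have hu := hpow _ (orderOf_pos (g * b⁻¹)).ne' hb.2.2
    have hcomm : Commute g b := by
      obtain ⟨i, rfl⟩ := hb.1
      exact (Commute.refl g).zpow_right i
    have : g ^ orderOf (g * b⁻¹) = b ^ orderOf (g * b⁻¹) := by
      have := pow_orderOf_eq_one (g * b⁻¹)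
      rwa [hcomm.inv_right.mul_pow, inv_pow, mul_inv_eq_one] at this
    rw [← hu g, this, hu b]
  have hgen : ∀ a b : G, Subgroup.zpowers a = Subgroup.zpowers b → f a = f b := by
    intro a b hab
    obtain ⟨k, rfl⟩ : a ∈ Submonoid.powers b := by
      rw [mem_powers_iff_mem_zpowers, ← hab]
      exact Subgroup.mem_zpowers a
    have hord : orderOf (b ^ k) = orderOf b := by
      rw [← Nat.card_zpowers, ← Nat.card_zpowers b, ← hab]
    have hcop : k.Coprime (orderOf b) := by
      rw [orderOf_pow] at hord
      have hgcd : Nat.gcd (orderOf b) k ∣ orderOf b := Nat.gcd_dvd_left _ _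
      have h1 := Nat.div_mul_cancel hgcd
      rw [hord] at h1
      exact (Nat.gcd_comm _ _).trans
        (Nat.eq_of_mul_eq_mul_left (orderOf_pos b) (by rw [h1, mul_one]))
    obtain ⟨q, hqm, hq, hqk⟩ :=
      Nat.forall_exists_prime_gt_and_modEq m (orderOf_pos b).ne' hcop
    have hbq : b ^ q = b ^ k := pow_eq_pow_iff_modEq.2 hqk
    change f (b ^ k) = f b
    rw [← hbq]
    exact hprime q hq (fun h => absurd (Nat.le_of_dvd (Nat.pos_of_ne_zero hm) h) (by lia)) b
  obtain ⟨a, ha⟩ := exists_isPPrimePart P x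
  obtain ⟨b, hb⟩ := exists_isPPrimePart P y
  obtain ⟨c, hc⟩ := h
  rw [← ha.zpowers_eq, ← hb.zpowers_eq, MonoidHom.map_zpowers] at hc
  rw [hpart x a ha, hpart y b hb, ← hgen _ _ hc]
  exact (hconj c a).symm

end Main

/-- the primitive idempotents of the real representation ring `RO_P(G)` are
precisely the functions `e_C`, where `C` ranges over (representatives of conjugacy classes
of) cyclic `P`-perfect subgroups of `G`. -/
theorem primitive_idempotents_of_real_representation_ring (G : Type) [Group G] [Fintype G]
    (P : Set ℕ) (hP : ∀ p ∈ P, Nat.Prime p) :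
    (∀ C : Subgroup G, CyclicPPerfect P C →
      IsPrimitiveIdempotentIn (ROP G P) (eIdem P C)) ∧
    (∀ f : G → ℂ, IsPrimitiveIdempotentIn (ROP G P) f →
      ∃ C : Subgroup G, CyclicPPerfect P C ∧ f = eIdem P C) := by
  simp only [IsPrimitiveIdempotentIn, mem_ROP_iff]
  have hone : ∀ {C : Subgroup G} {g : G}, SubConj (primePartSubgroup P g) C →
      eIdem P C g = 1 := fun {C g} h => by rw [eIdem_apply, if_pos h]
  have hzero : ∀ {C : Subgroup G} {g : G}, ¬ SubConj (primePartSubgroup P g) C →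
      eIdem P C g = 0 := fun {C g} h => by rw [eIdem_apply, if_neg h]
  have hidem : ∀ C : Subgroup G, eIdem P C * eIdem P C = eIdem P C := fun C => funext fun g => by
    by_cases h : SubConj (primePartSubgroup P g) C
    · simp [hone h]
    · simp [hzero h]
  have hself : ∀ C : Subgroup G, SubConj C C := fun C => ⟨1, by ext; simp⟩
  constructor
  · rintro C ⟨⟨x, hx⟩, hC⟩
    have hxC : Subgroup.zpowers (x : G) = C := by
      refine le_antisymm (Subgroup.zpowers_le.2 x.2) fun z hz => ?_
      obtain ⟨k, hk⟩ := hx ⟨z, hz⟩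
      exact ⟨k, by simpa using congrArg Subtype.val hk⟩
    have hx : SubConj (primePartSubgroup P (x : G)) C := by
      rw [primePartSubgroup_eq_zpowers_of_cyclicPPerfect (by rwa [hxC]), hxC]
      exact hself C
    refine ⟨eIdem_mem_ROPSubalgebra P C, hidem C, fun h => ?_, ?_⟩
    · have := hone hx
      simp [h] at this
    · intro e₁ e₂ h₁ h₂ hi₁ hi₂ h12 hsum
      have key : ∀ e e' : G → ℂ, e ∈ ROPSubalgebra G P → e * e = e → e * e' = 0 →
          eIdem P C = e + e' → e x = 0 → e = 0 := by
        intro e e' he hi hee' hsum h0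
        funext g
        by_cases hg : SubConj (primePartSubgroup P g) C
        · rw [apply_eq_of_subConj_of_idempotent he hi (hg.trans hx.symm), h0]
          rfl
        · have h1 : 0 = e g + e' g := by
            rw [← hzero hg, hsum]
            rfl
          have h2 : e g * e g = e g := congrFun hi g
          have h3 : e g * e' g = 0 := congrFun hee' g
          change e g = 0
          linear_combination -h2 - h3 - e g * h1
      have h12x : e₁ x * e₂ x = 0 := congrFun h12 x
      rcases mul_eq_zero.1 h12x with h | h
      · exact Or.inl (key e₁ e₂ h₁ hi₁ h12 hsum h)
      · exact Or.inr (key e₂ e₁ h₂ hi₂ (by rwa [mul_comm]) (by rwa [add_comm]) h)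
  · rintro f ⟨hf, hi, hf0, hprim⟩
    obtain ⟨x, hx⟩ : ∃ x, f x ≠ 0 := Function.ne_iff.1 hf0
    have hx1 : f x = 1 := (IsIdempotentElem.iff_eq_zero_or_one.1
      (congrFun hi x : f x * f x = f x)).resolve_left hx
    set C := primePartSubgroup P x
    refine ⟨C, cyclicPPerfect_primePartSubgroup P x, ?_⟩
    have he := eIdem_mem_ROPSubalgebra P C
    have hee := hidem C
    rcases hprim (f * eIdem P C) (f * (1 - eIdem P C)) (mul_mem hf he)
      (mul_mem hf (sub_mem (one_mem _) he))
      (by rw [mul_mul_mul_comm, hi, hee])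
      (by rw [mul_mul_mul_comm, hi, mul_sub, mul_one, sub_mul, one_mul, hee, sub_self, sub_zero])
      (by rw [mul_mul_mul_comm, mul_sub, mul_one, hee, sub_self, mul_zero])
      (by rw [← mul_add, add_sub_cancel, mul_one]) with h | h
    · have := congrFun h x
      simp [hx1, hone (hself C)] at this
    · funext g
      have hg := congrFun h g
      by_cases hgC : SubConj (primePartSubgroup P g) C
      · rw [hone hgC, apply_eq_of_subConj_of_idempotent hf hi hgC, hx1]
      · simpa [hzero hgC] using hg
end

section
/- Let G be a finite group, p a prime number, and let f be a ℤ_(p)-linear combination (inside the ring of functions G → ℂ) of characters of finite-dimensional complex representations of G, where ℤ_(p) = ℤ[1/q : q prime, q ≠ p] ⊆ ℚ. Let O be the ring of algebraic integers of the subfield F ⊆ ℂ generated by the e(G)-th roots of unity (e(G) the exponent of G), let O_(p) = O[1/q : q prime, q ≠ p] ⊆ F, and let 𝔭 be a maximal ideal of O_(p) (equivalently, a nonzero prime ideal; all such lie over p). Then for every g ∈ G, f(g) ≡ f(g_{p'}) modulo 𝔭, i.e. f(g) − f(g_{p'}) ∈ 𝔭 (all values of f lie in O_(p)). -/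
/-- The subring `ℤ_(p) = ℤ[1/q : q prime, q ≠ p]` of `ℚ`, viewed inside `ℂ`. -/
noncomputable def Zploc (p : ℕ) : Subring ℂ :=
  Subring.closure {z : ℂ | ∃ q : ℕ, q.Prime ∧ q ≠ p ∧ z = (q : ℂ)⁻¹}

/-- The subfield `F ⊆ ℂ` generated by the `e`-th roots of unity. -/
noncomputable def cycField (e : ℕ) : Subfield ℂ :=
  Subfield.closure {z : ℂ | z ^ e = 1}

/-- The subring `O_(p) = O[1/q : q prime, q ≠ p]` of `F ⊆ ℂ`, where `O` is the ring of
algebraic integers of `F = cycField e`. -/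
noncomputable def Oploc (e p : ℕ) : Subring ℂ :=
  Subring.closure ({z : ℂ | z ∈ cycField e ∧ IsIntegral ℤ z} ∪
    {z : ℂ | ∃ q : ℕ, q.Prime ∧ q ≠ p ∧ z = (q : ℂ)⁻¹})

/-- `b` is the `p'`-part of `g`: a power of `g` of order prime to `p` such that
`g * b⁻¹` has `p`-power order. -/
def IspPrimePart {G : Type} [Group G] (p : ℕ) (g b : G) : Prop :=
  b ∈ Subgroup.zpowers g ∧ ¬ p ∣ orderOf b ∧
    (∀ q : ℕ, q.Prime → q ∣ orderOf (g * b⁻¹) → q = p)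

/-- If every eigenvalue of a semisimple endomorphism `T` is sent into the additive subgroup `A`
by the polynomial `P`, then the trace of `P(T)` lies in `A`. -/
theorem Module.End.IsSemisimple.trace_aeval_mem {K V : Type*} [Field K] [IsAlgClosed K]
    [AddCommGroup V] [Module K V] [FiniteDimensional K V] {T : Module.End K V}
    (hT : T.IsSemisimple) (P : Polynomial K) (A : AddSubgroup K)
    (hA : ∀ μ, T.HasEigenvalue μ → P.eval μ ∈ A) :
    LinearMap.trace K V (Polynomial.aeval T P) ∈ A := by
  classical
  have hint : DirectSum.IsInternal T.eigenspace :=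
    (DirectSum.isInternal_submodule_iff_iSupIndep_and_iSup_eq_top _).2
      ⟨T.eigenspaces_iSupIndep,
        hT.iSup_maxGenEigenspace_eq_top_iff.1 (Module.End.iSup_maxGenEigenspace_eq_top T)⟩
  have haeval : ∀ μ, ∀ v ∈ T.eigenspace μ, Polynomial.aeval T P v = P.eval μ • v := by
    intro μ v hv
    by_cases hv0 : v = 0
    · simp [hv0]
    · exact Module.End.aeval_apply_of_hasEigenvector ⟨hv, hv0⟩
  have hmaps : ∀ μ, Set.MapsTo (Polynomial.aeval T P) (T.eigenspace μ) (T.eigenspace μ) := by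
    intro μ v hv
    rw [SetLike.mem_coe, haeval μ v hv]
    exact Submodule.smul_mem _ _ hv
  have hfin : {μ | T.eigenspace μ ≠ ⊥}.Finite :=
    WellFoundedGT.finite_ne_bot_of_iSupIndep T.eigenspaces_iSupIndep
  rw [LinearMap.trace_eq_sum_trace_restrict' hint hfin hmaps]
  refine sum_mem fun μ hμ ↦ ?_
  have hres : (Polynomial.aeval T P).restrict (hmaps μ) = P.eval μ • LinearMap.id := by
    ext v
    exact haeval μ v v.2
  rw [hres, map_smul, LinearMap.trace_id, smul_eq_mul, mul_comm, ← nsmul_eq_mul]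
  exact nsmul_mem (hA μ (hfin.mem_toFinset.1 hμ)) _

/-- An endomorphism of finite order is semisimple in characteristic zero. -/
theorem Module.End.isSemisimple_of_pow_eq_one {K V : Type*} [Field K] [CharZero K]
    [AddCommGroup V] [Module K V] [FiniteDimensional K V] {T : Module.End K V} {n : ℕ}
    (hn : n ≠ 0) (hT : T ^ n = 1) : T.IsSemisimple := by
  refine Module.End.isSemisimple_of_squarefree_aeval_eq_zero (p := Polynomial.X ^ n - 1) ?_ ?_
  · exact (Polynomial.X_pow_sub_one_separable_iff.2 (by exact_mod_cast hn)).squarefree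
  · simp [hT]

theorem inv_natCast_mem_Zploc {p s : ℕ} (hs : ¬ p ∣ s) : (s : ℂ)⁻¹ ∈ Zploc p := by
  induction s using Nat.recOnMul with
  | zero => exact absurd (dvd_zero p) hs
  | one => simp
  | prime q hq =>
    exact Subring.subset_closure ⟨q, hq, fun h ↦ hs (h ▸ dvd_rfl), rfl⟩
  | mul a b ha hb =>
    rw [Nat.cast_mul, mul_inv]
    exact mul_mem (ha fun h ↦ hs (h.mul_right b)) (hb fun h ↦ hs (h.mul_left a))

theorem exists_mul_eq_intCast_of_mem_Zploc {p : ℕ} (hp : p.Prime) {z : ℂ} (hz : z ∈ Zploc p) :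
    ∃ (s : ℕ) (r : ℤ), ¬ p ∣ s ∧ (s : ℂ) * z = r := by
  induction hz using Subring.closure_induction with
  | mem x hx =>
    obtain ⟨q, hq, hqp, rfl⟩ := hx
    refine ⟨q, 1, fun h ↦ hqp ((Nat.prime_dvd_prime_iff_eq hp hq).1 h).symm, ?_⟩
    simp [hq.ne_zero]
  | zero => exact ⟨1, 0, hp.not_dvd_one, by simp⟩
  | one => exact ⟨1, 1, hp.not_dvd_one, by simp⟩
  | add x y _ _ hx hy =>
    obtain ⟨s, r, hs, h⟩ := hx
    obtain ⟨s', r', hs', h'⟩ := hy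
    refine ⟨s * s', s' * r + s * r', hp.not_dvd_mul hs hs', ?_⟩
    push_cast
    linear_combination (s' : ℂ) * h + (s : ℂ) * h'
  | neg x _ hx =>
    obtain ⟨s, r, hs, h⟩ := hx
    exact ⟨s, -r, hs, by simp [h]⟩
  | mul x y _ _ hx hy =>
    obtain ⟨s, r, hs, h⟩ := hx
    obtain ⟨s', r', hs', h'⟩ := hy
    refine ⟨s * s', r * r', hp.not_dvd_mul hs hs', ?_⟩
    push_cast
    rw [← h, ← h']
    ring

theorem intCast_isUnit_Zploc {p : ℕ} {t : ℤ} (ht : ¬ (p : ℤ) ∣ t) :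
    IsUnit (t : Zploc p) := by
  have ht' : ¬ p ∣ t.natAbs := fun h ↦ ht (Int.natCast_dvd.2 h)
  have hnat : IsUnit ((t.natAbs : ℕ) : Zploc p) := by
    refine IsUnit.of_mul_eq_one ⟨_, inv_natCast_mem_Zploc ht'⟩ (Subtype.ext ?_)
    have : (t.natAbs : ℂ) ≠ 0 := Nat.cast_ne_zero.2 fun h ↦ ht' (h ▸ dvd_zero p)
    push_cast
    exact mul_inv_cancel₀ this
  rcases Int.natAbs_eq t with h | h <;> rw [h]
  · simpa using hnat
  · simpa using hnat.neg

theorem natCast_mem_of_isMaximal_Zploc {p : ℕ} (hp : p.Prime) (𝔪 : Ideal (Zploc p))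
    (h𝔪 : 𝔪.IsMaximal) : (p : Zploc p) ∈ 𝔪 := by
  by_contra hpm
  obtain ⟨y, m, hm, h⟩ := h𝔪.exists_inv hpm
  obtain ⟨s, r, hs, hsr⟩ := exists_mul_eq_intCast_of_mem_Zploc hp y.2
  have hsr' : (s : Zploc p) * y = r := Subtype.ext (by push_cast; exact hsr)
  have hunit : IsUnit ((s - p * r : ℤ) : Zploc p) := by
    refine intCast_isUnit_Zploc fun hd ↦ hs ?_
    exact Int.natCast_dvd_natCast.1 ((dvd_sub_left (dvd_mul_right _ _)).1 hd)
  refine h𝔪.ne_top (𝔪.eq_top_of_isUnit_mem ?_ hunit)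
  have : ((s - p * r : ℤ) : Zploc p) = s * m := by
    push_cast
    linear_combination (-(s : Zploc p)) * h - (p : Zploc p) * (-hsr')
  rw [this]
  exact 𝔪.mul_mem_left _ hm

theorem Zploc_le_Oploc (e p : ℕ) : Zploc p ≤ Oploc e p :=
  Subring.closure_mono Set.subset_union_right

theorem inclusion_Zploc_Oploc_isIntegral (e p : ℕ) :
    (Subring.inclusion (Zploc_le_Oploc e p)).IsIntegral := by
  intro x
  have hle : Oploc e p ≤ (integralClosure (Zploc p) ℂ).toSubring := by
    refine Subring.closure_le.2 ?_
    rintro z (hz | ⟨q, hq, hqp, rfl⟩)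
    · exact hz.2.tower_top
    · exact isIntegral_algebraMap (R := Zploc p)
        (x := ⟨_, Subring.subset_closure ⟨q, hq, hqp, rfl⟩⟩)
  obtain ⟨P, hP, h⟩ := hle x.2
  refine ⟨P, hP, Subtype.ext ?_⟩
  have := Polynomial.hom_eval₂ P (Subring.inclusion (Zploc_le_Oploc e p)) (Oploc e p).subtype x
  exact this.trans h

theorem natCast_mem_of_isMaximal_Oploc {e p : ℕ} (hp : p.Prime) (𝔭 : Ideal (Oploc e p))
    (h𝔭 : 𝔭.IsMaximal) : (p : Oploc e p) ∈ 𝔭 := by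
  have := natCast_mem_of_isMaximal_Zploc hp _
    (Ideal.isMaximal_comap_of_isIntegral_of_isMaximal' _
      (inclusion_Zploc_Oploc_isIntegral e p) 𝔭)
  simpa [Ideal.mem_comap] using this

theorem Ideal.sub_mem_of_pow_prime_pow_eq {R : Type*} [CommRing R] {p : ℕ} (hp : p.Prime)
    {I : Ideal R} (hI : I.IsPrime) (hpI : (p : R) ∈ I) {x y : R} {m : ℕ}
    (h : x ^ p ^ m = y ^ p ^ m) : x - y ∈ I := by
  have := Fact.mk hp
  have hp0 : ((p : ℕ) : R ⧸ I) = 0 := by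
    rw [← map_natCast (Ideal.Quotient.mk I), Ideal.Quotient.eq_zero_iff_mem.2 hpI]
  have : CharP (R ⧸ I) p := (CharP.charP_iff_prime_eq_zero hp).2 hp0
  have : ExpChar (R ⧸ I) p := ExpChar.prime hp
  rw [← Ideal.Quotient.eq_zero_iff_mem]
  refine eq_zero_of_pow_eq_zero (n := p ^ m) ?_
  rw [map_sub, sub_pow_expChar_pow, ← map_pow, ← map_pow, h, sub_self]

theorem IspPrimePart.exists_pow {G : Type} [Group G] [Finite G] {p : ℕ} {g b : G}
    (hb : IspPrimePart p g b) : ∃ k m : ℕ, b = g ^ k ∧ g ^ p ^ m = (g ^ k) ^ p ^ m := by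
  obtain ⟨hbg, -, hq⟩ := hb
  obtain ⟨k, rfl⟩ := (mem_powers_iff_mem_zpowers (x := g)).2 hbg
  have hord := Nat.eq_prime_pow_of_unique_prime_dvd
    (orderOf_pos (g * (g ^ k)⁻¹)).ne' fun {q} h h' ↦ hq q h h'
  refine ⟨k, (orderOf (g * (g ^ k)⁻¹)).primeFactorsList.length, rfl, ?_⟩
  have hpow := pow_orderOf_eq_one (g * (g ^ k)⁻¹)
  rw [hord, ((Commute.refl g).pow_right k).inv_right.mul_pow, inv_pow, mul_inv_eq_one] at hpow
  exact hpow

theorem FDRep.character_sub_character_mem {G : Type} [Group G] [Fintype G] {p : ℕ}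
    (hp : p.Prime) (V : FDRep ℂ G) (𝔭 : Ideal (Oploc (Monoid.exponent G) p))
    (h𝔭 : 𝔭.IsMaximal) {g b : G} (hb : IspPrimePart p g b) :
    ∃ a ∈ 𝔭, (a : ℂ) = V.character g - V.character b := by
  obtain ⟨k, m, rfl, hkm⟩ := hb.exists_pow
  have hexp : Monoid.exponent G ≠ 0 := Monoid.exponent_ne_zero_of_finite
  have hone : (V.ρ g) ^ Monoid.exponent G = 1 := by
    rw [← map_pow, Monoid.pow_exponent_eq_one, map_one]
  have hmem := (Module.End.isSemisimple_of_pow_eq_one hexp hone).trace_aeval_mem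
    (Polynomial.X - Polynomial.X ^ k)
    (𝔭.toAddSubgroup.map (Oploc (Monoid.exponent G) p).subtype.toAddMonoidHom) ?_
  · obtain ⟨a, ha, h⟩ := hmem
    refine ⟨a, ha, h.trans ?_⟩
    simp [FDRep.character]
  · intro μ hμ
    obtain ⟨v, hv⟩ := hμ.exists_hasEigenvector
    have hroot : μ ^ Monoid.exponent G = 1 := by
      have := hv.pow_apply (Monoid.exponent G)
      rw [hone, Module.End.one_apply] at this
      exact (smul_left_injective ℂ hv.2 (by simpa using this)).symm
    have hpow : μ ^ p ^ m = (μ ^ k) ^ p ^ m := by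
      have h := hv.pow_apply (p ^ m)
      rw [← map_pow, hkm, ← pow_mul, map_pow, hv.pow_apply, pow_mul] at h
      exact (smul_left_injective ℂ hv.2 h).symm
    have hμO : μ ∈ Oploc (Monoid.exponent G) p :=
      Subring.subset_closure (Or.inl ⟨Subfield.subset_closure hroot,
        IsIntegral.of_pow (Nat.pos_of_ne_zero hexp) (hroot ▸ isIntegral_one)⟩)
    refine ⟨⟨μ, hμO⟩ - ⟨μ, hμO⟩ ^ k, ?_, by simp⟩
    exact Ideal.sub_mem_of_pow_prime_pow_eq hp h𝔭.isPrime
      (natCast_mem_of_isMaximal_Oploc hp 𝔭 h𝔭) (m := m) (Subtype.ext (by simpa using hpow))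

/-- STATEMENT 16: for `f` a `ℤ_(p)`-linear combination of complex characters of `G` and
`𝔭` a maximal ideal of `O_(p)`, one has `f(g) ≡ f(g_{p'}) (mod 𝔭)` for all `g ∈ G`. -/
theorem character_congruent_p_prime_part (G : Type) [Group G] [Fintype G]
    (p : ℕ) (hp : p.Prime)
    (f : G → ℂ) (hf : ∃ (n : ℕ) (c : Fin n → ℂ) (V : Fin n → FDRep ℂ G),
      (∀ i, c i ∈ Zploc p) ∧ f = ∑ i, c i • (V i).character)
    (𝔭 : Ideal ↥(Oploc (Monoid.exponent G) p)) (h𝔭 : 𝔭.IsMaximal)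
    (g b : G) (hb : IspPrimePart p g b) :
    ∃ a : ↥(Oploc (Monoid.exponent G) p), a ∈ 𝔭 ∧ (a : ℂ) = f g - f b := by
  obtain ⟨n, c, V, hc, rfl⟩ := hf
  choose a ha hav using fun i ↦ FDRep.character_sub_character_mem hp (V i) 𝔭 h𝔭 hb
  refine ⟨∑ i, ⟨c i, Zploc_le_Oploc _ _ (hc i)⟩ * a i,
    sum_mem fun i _ ↦ 𝔭.mul_mem_left _ (ha i), ?_⟩
  simp [hav, mul_sub, Finset.sum_sub_distrib]
end

section
/- Let G be a finite group and let C ≤ G be any cyclic subgroup. Then the function e_C : G → ℂ defined by e_C(g) = 1 if ⟨g⟩ is conjugate in G to C and e_C(g) = 0 otherwise lies in RU_ℚ(G), and it is a primitive idempotent element of the ring RU_ℚ(G). -/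
open scoped Classical

/-- The function `e_C : G → ℂ` with `e_C(g) = 1` if `⟨g⟩` is conjugate in `G` to `C`
and `e_C(g) = 0` otherwise. -/
noncomputable def eCyc {G : Type} [Group G] (C : Subgroup G) : G → ℂ :=
  fun g => if SubConj (Subgroup.zpowers g) C then 1 else 0

/-- `RU_ℚ(G)`: `ℚ`-linear combinations, inside the ring of functions `G → ℂ`, of
characters of finite-dimensional complex representations of `G`. -/
noncomputable def RUQ (G : Type) [Group G] [Fintype G] : Set (G → ℂ) :=
  {f | ∃ (n : ℕ) (c : Fin n → ℚ) (V : Fin n → FDRep ℂ G),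
    f = ∑ i, (c i : ℂ) • (V i).character}

open scoped Pointwise

section Closure

variable {G : Type} [Group G] [Fintype G]

theorem RUQ_character (V : FDRep ℂ G) : V.character ∈ RUQ G :=
  ⟨1, fun _ => 1, fun _ => V, by simp⟩

theorem RUQ_zero : (0 : G → ℂ) ∈ RUQ G :=
  ⟨0, Fin.elim0, Fin.elim0, by simp⟩

theorem RUQ_smul {f : G → ℂ} (hf : f ∈ RUQ G) (q : ℚ) : (q : ℂ) • f ∈ RUQ G := by
  obtain ⟨n, c, V, rfl⟩ := hf
  exact ⟨n, fun i => q * c i, V, by simp [Finset.smul_sum, mul_smul]⟩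

theorem RUQ_add {f f' : G → ℂ} (hf : f ∈ RUQ G) (hf' : f' ∈ RUQ G) : f + f' ∈ RUQ G := by
  obtain ⟨n, c, V, rfl⟩ := hf
  obtain ⟨m, d, W, rfl⟩ := hf'
  exact ⟨n + m, Fin.append c d, Fin.append V W, by simp [Fin.sum_univ_add]⟩

theorem RUQ_sum {ι : Type*} (s : Finset ι) {f : ι → G → ℂ} (hf : ∀ i ∈ s, f i ∈ RUQ G) :
    ∑ i ∈ s, f i ∈ RUQ G :=
  Finset.sum_induction f (· ∈ RUQ G) (fun _ _ => RUQ_add) RUQ_zero hf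

end Closure

section Permutation

/-- The permutation representation of `G` on the functions on a `G`-set. -/
noncomputable def permFunRep (G X : Type) [Group G] [MulAction G X] :
    Representation ℂ G (X → ℂ) where
  toFun g := LinearMap.funLeft ℂ ℂ (fun x => g⁻¹ • x)
  map_one' := by ext; simp [LinearMap.funLeft]
  map_mul' g h := by
    refine LinearMap.ext fun f => funext fun x => ?_
    simp [LinearMap.funLeft, mul_smul]

theorem trace_permFunRep (G X : Type) [Group G] [MulAction G X] [Fintype X] (g : G) :
    LinearMap.trace ℂ (X → ℂ) (permFunRep G X g) = Nat.card (MulAction.fixedBy X g) := by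
  rw [LinearMap.trace_eq_matrix_trace ℂ (Pi.basisFun ℂ X), Matrix.trace]
  simp only [Matrix.diag_apply, LinearMap.toMatrix_apply, Pi.basisFun_repr, Pi.basisFun_apply,
    permFunRep, MonoidHom.coe_mk, OneHom.coe_mk, LinearMap.funLeft_apply, Pi.single_apply]
  rw [Finset.sum_boole, Nat.card_eq_fintype_card, Fintype.card_subtype]
  congr 2
  ext x
  simp only [Finset.mem_filter, Finset.mem_univ, true_and, MulAction.mem_fixedBy]
  rw [inv_smul_eq_iff, eq_comm]

variable {G : Type} [Group G]

theorem card_fixedBy_mem_RUQ [Fintype G] (X : Type) [MulAction G X] [Fintype X] :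
    (fun g : G => (Nat.card (MulAction.fixedBy X g) : ℂ)) ∈ RUQ G := by
  convert RUQ_character (FDRep.of (permFunRep G X)) using 1
  ext g
  exact (trace_permFunRep G X g).symm

theorem card_conj_mem (C : Subgroup G) (g : G) :
    Nat.card {x : G // x⁻¹ * g * x ∈ C} =
      Nat.card C * Nat.card (MulAction.fixedBy (G ⧸ C) g) := by
  rw [← Nat.card_prod,
    ← Nat.card_congr (QuotientGroup.preimageMkEquivSubgroupProdSet C (MulAction.fixedBy (G ⧸ C) g))]
  refine Nat.card_congr (Equiv.subtypeEquivRight fun x => ?_)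
  rw [Set.mem_preimage, MulAction.mem_fixedBy, eq_comm, MulAction.Quotient.smul_mk,
    QuotientGroup.eq, smul_eq_mul, mul_assoc]

theorem conj_smul_zpowers (x g : G) :
    MulAut.conj x • Subgroup.zpowers g = Subgroup.zpowers (x * g * x⁻¹) :=
  MonoidHom.map_zpowers (MulAut.conj x).toMonoidHom g

theorem subConj_iff (C D : Subgroup G) : SubConj C D ↔ ∃ x : G, MulAut.conj x • C = D :=
  Iff.rfl

theorem card_zpowers_conj_eq [Fintype G] (D : Subgroup G) (g : G) :
    (Nat.card {x : G // Subgroup.zpowers (x⁻¹ * g * x) = D} : ℂ) =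
      (Nat.card {x : G // MulAut.conj x⁻¹ • D = D} : ℂ) * eCyc D g := by
  have key (x : G) : Subgroup.zpowers (x⁻¹ * g * x) = MulAut.conj x⁻¹ • Subgroup.zpowers g := by
    rw [conj_smul_zpowers, inv_inv]
  unfold eCyc
  split_ifs with h
  · obtain ⟨y, hy⟩ := (subConj_iff _ _).1 h
    rw [mul_one, Nat.cast_inj]
    refine Nat.card_congr ((Equiv.mulLeft y).subtypeEquiv fun x => ?_)
    rw [key, Equiv.coe_mulLeft, mul_inv_rev, map_mul, mul_smul]
    nth_rewrite 2 [← hy]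
    rw [smul_smul (MulAut.conj y⁻¹), ← map_mul, inv_mul_cancel, map_one, one_smul]
  · rw [mul_zero, Nat.cast_eq_zero]
    have : IsEmpty {x : G // Subgroup.zpowers (x⁻¹ * g * x) = D} :=
      ⟨fun x => h ((subConj_iff _ _).2 ⟨_, (key x.1).symm.trans x.2⟩)⟩
    exact Nat.card_of_isEmpty

theorem card_mul_card_fixedBy_eq_sum [Fintype G] (C : Subgroup G) (g : G) :
    (Nat.card C : ℂ) * Nat.card (MulAction.fixedBy (G ⧸ C) g) =
      ∑ D : Subgroup G with D ≤ C,
        (Nat.card {x : G // MulAut.conj x⁻¹ • D = D} : ℂ) * eCyc D g := by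
  simp_rw [← card_zpowers_conj_eq]
  rw [← Nat.cast_mul, ← card_conj_mem, ← Nat.cast_sum, Nat.cast_inj, Nat.card_eq_fintype_card,
    Fintype.card_subtype, Finset.card_eq_sum_card_fiberwise
      (f := fun x => Subgroup.zpowers (x⁻¹ * g * x)) (t := {D : Subgroup G | D ≤ C})]
  · refine Finset.sum_congr rfl fun D hD => ?_
    rw [Nat.card_eq_fintype_card, Fintype.card_subtype]
    congr 1
    ext x
    simp only [Finset.mem_filter, Finset.mem_univ, true_and, and_iff_right_iff_imp] at hD ⊢
    rintro rfl
    exact Subgroup.zpowers_le.1 hD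
  · intro x hx
    simpa using hx

theorem eCyc_mem_RUQ [Fintype G] (C : Subgroup G) : eCyc C ∈ RUQ G := by
  induction C using WellFoundedLT.induction with
  | ind C ih =>
  set a : Subgroup G → ℚ := fun D => Nat.card {x : G // MulAut.conj x⁻¹ • D = D} with ha
  have hpos : a C ≠ 0 := by
    have : Nonempty {x : G // MulAut.conj x⁻¹ • C = C} := ⟨1, by simp⟩
    simp only [ha, ne_eq, Nat.cast_eq_zero]
    exact Nat.card_pos.ne'
  have hsplit : (Finset.univ.filter fun D : Subgroup G => D ≤ C) =
      insert C (Finset.univ.filter fun D : Subgroup G => D < C) := by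
    ext D
    simp [le_iff_eq_or_lt]
  have hmem := RUQ_smul (RUQ_add
    (RUQ_smul (card_fixedBy_mem_RUQ (G := G) (G ⧸ C)) (Nat.card C))
    (RUQ_smul (RUQ_sum (Finset.univ.filter fun D : Subgroup G => D < C)
      (f := fun D => (a D : ℂ) • eCyc D)
      fun D hD => RUQ_smul (ih D (Finset.mem_filter.1 hD).2) (a D)) (-1))) (a C)⁻¹
  convert hmem using 1
  ext g
  have h := card_mul_card_fixedBy_eq_sum C g
  rw [hsplit, Finset.sum_insert (by simp)] at h
  have hpos' : (a C : ℂ) ≠ 0 := by exact_mod_cast hpos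
  simp only [Pi.smul_apply, Pi.add_apply, smul_eq_mul, Finset.sum_apply, Rat.cast_natCast, h,
    Rat.cast_inv, Rat.cast_neg, Rat.cast_one, ha] at hpos' ⊢
  field_simp
  ring

end Permutation

section Trace

open Polynomial

theorem IsIdempotentElem.trace_eq_finrank_range {V : Type*} [AddCommGroup V] [Module ℂ V]
    [FiniteDimensional ℂ V] {p : V →ₗ[ℂ] V} (hp : IsIdempotentElem p) :
    LinearMap.trace ℂ V p = Module.finrank ℂ (LinearMap.range p) :=
  (LinearMap.IsIdempotentElem.isProj_range p hp).trace

/-- The traces of the powers of an operator of finite order `n` are the values of one rational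
polynomial at the powers of a primitive `n`-th root of unity. -/
theorem exists_polynomial_trace_pow {V : Type*} [AddCommGroup V] [Module ℂ V]
    [FiniteDimensional ℂ V] {A : V →ₗ[ℂ] V} {n : ℕ} (hn : 0 < n) (hA : A ^ n = 1) {ζ : ℂ}
    (hζ : IsPrimitiveRoot ζ n) :
    ∃ P : ℚ[X], ∀ k : ℕ, LinearMap.trace ℂ V (A ^ k) = aeval (ζ ^ k) P := by
  have hn0 : (n : ℂ) ≠ 0 := by exact_mod_cast hn.ne'
  have hζ0 : ζ ≠ 0 := hζ.ne_zero hn.ne'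
  let p : ℕ → V →ₗ[ℂ] V := fun j =>
    (n : ℂ)⁻¹ • ∑ i ∈ Finset.range n, ((ζ ^ j)⁻¹ • A) ^ i
  have hAp (j : ℕ) : A * p j = ζ ^ j • p j := by
    have hB : ((ζ ^ j)⁻¹ • A) ^ n = 1 := by
      rw [_root_.smul_pow, hA, inv_pow, ← pow_mul, mul_comm, pow_mul, hζ.pow_eq_one]
      simp
    have h := mul_geom_sum ((ζ ^ j)⁻¹ • A) n
    rw [hB, sub_self, sub_mul, one_mul, sub_eq_zero, smul_mul_assoc,
      inv_smul_eq_iff₀ (pow_ne_zero _ hζ0)] at h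
    simp only [p, mul_smul_comm, h]
    rw [smul_comm]
  have hApow (j k : ℕ) : A ^ k * p j = (ζ ^ k) ^ j • p j := by
    induction k with
    | zero => simp
    | succ k ih => rw [pow_succ, mul_assoc, hAp, mul_smul_comm, ih, smul_smul]; congr 1; ring
  have hidem (j : ℕ) : IsIdempotentElem (p j) := by
    change ((n : ℂ)⁻¹ • ∑ i ∈ Finset.range n, ((ζ ^ j)⁻¹ • A) ^ i) * p j = p j
    rw [smul_mul_assoc, Finset.sum_mul]
    have : ∀ i ∈ Finset.range n, ((ζ ^ j)⁻¹ • A) ^ i * p j = p j := fun i _ => by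
      rw [_root_.smul_pow, smul_mul_assoc, hApow, smul_smul, inv_pow, ← pow_mul, ← pow_mul, mul_comm i j,
        inv_mul_cancel₀ (pow_ne_zero _ hζ0), one_smul]
    rw [Finset.sum_congr rfl this, Finset.sum_const, Finset.card_range, ← Nat.cast_smul_eq_nsmul ℂ,
      inv_smul_smul₀ hn0]
  have hsum : ∑ j ∈ Finset.range n, p j = 1 := by
    simp only [p, ← Finset.smul_sum]
    rw [Finset.sum_comm, Finset.sum_eq_single 0]
    · simp [← Nat.cast_smul_eq_nsmul ℂ, smul_smul, hn0]
    · intro i hi hi0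
      simp_rw [_root_.smul_pow, ← Finset.sum_smul, inv_pow, ← pow_mul, mul_comm _ i, pow_mul, ← inv_pow]
      have hne : (ζ ^ i)⁻¹ - 1 ≠ 0 := by
        rw [sub_ne_zero, ne_eq, inv_eq_one]
        exact hζ.pow_ne_one_of_pos_of_lt hi0 (Finset.mem_range.1 hi)
      have h0 : ∑ j ∈ Finset.range n, (ζ ^ i)⁻¹ ^ j = 0 := by
        refine (mul_eq_zero.1 ?_).resolve_left hne
        rw [mul_geom_sum, inv_pow, ← pow_mul, mul_comm, pow_mul, hζ.pow_eq_one]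
        simp
      rw [inv_pow ζ i, h0, zero_smul]
    · intro h
      exact absurd (Finset.mem_range.2 hn) h
  refine ⟨∑ j ∈ Finset.range n,
    C (Module.finrank ℂ (LinearMap.range (p j)) : ℚ) * X ^ j, fun k => ?_⟩
  rw [← mul_one (A ^ k), ← hsum, Finset.mul_sum, map_sum, map_sum]
  refine Finset.sum_congr rfl fun j _ => ?_
  rw [hApow, map_smul, (hidem j).trace_eq_finrank_range]
  simp [mul_comm]

theorem aeval_pow_eq_of_coprime {n : ℕ} (hn : 0 < n) {ζ : ℂ} (hζ : IsPrimitiveRoot ζ n) {k : ℕ}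
    (hk : k.Coprime n) {P : ℚ[X]} {q : ℚ} (h : aeval ζ P = q) : aeval (ζ ^ k) P = q := by
  have hdvd : minpoly ℚ ζ ∣ P - C q := minpoly.dvd ℚ ζ (by simp [h])
  rw [← cyclotomic_eq_minpoly_rat hζ hn,
    cyclotomic_eq_minpoly_rat (hζ.pow_of_coprime k hk) hn] at hdvd
  have h0 := (minpoly.dvd_iff).1 hdvd
  simpa [sub_eq_zero] using h0

variable {G : Type} [Group G] [Fintype G]

theorem exists_polynomial_of_mem_RUQ {f : G → ℂ} (hf : f ∈ RUQ G) (g : G) {ζ : ℂ}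
    (hζ : IsPrimitiveRoot ζ (orderOf g)) : ∃ P : ℚ[X], ∀ k : ℕ, f (g ^ k) = aeval (ζ ^ k) P := by
  obtain ⟨n, c, V, rfl⟩ := hf
  have h (i : Fin n) : ∃ P : ℚ[X], ∀ k : ℕ, (V i).character (g ^ k) = aeval (ζ ^ k) P := by
    obtain ⟨P, hP⟩ := exists_polynomial_trace_pow (A := (V i).ρ g) (orderOf_pos g)
      (by rw [← map_pow, pow_orderOf_eq_one, map_one]) hζ
    exact ⟨P, fun k => by rw [← hP, ← map_pow, FDRep.character]⟩
  choose P hP using h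
  exact ⟨∑ i, C (c i) * P i, fun k => by simp [hP]⟩

theorem RUQ_eq_of_zpowers_eq {f : G → ℂ} (hf : f ∈ RUQ G) {g h : G}
    (hgh : Subgroup.zpowers g = Subgroup.zpowers h) {q : ℚ} (hq : f g = q) : f h = q := by
  have hpos := orderOf_pos g
  have hζ := Complex.isPrimitiveRoot_exp (orderOf g) hpos.ne'
  obtain ⟨P, hP⟩ := exists_polynomial_of_mem_RUQ hf g hζ
  obtain ⟨k, rfl⟩ : ∃ k : ℕ, g ^ k = h :=
    mem_powers_iff_mem_zpowers.2 (hgh ▸ Subgroup.mem_zpowers h)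
  have hk : k.Coprime (orderOf g) := by
    have ho : orderOf (g ^ k) = orderOf g := by
      rw [← Nat.card_zpowers, ← hgh, Nat.card_zpowers]
    rw [orderOf_pow] at ho
    rw [Nat.coprime_comm]
    exact (Nat.div_eq_self.1 ho).resolve_left hpos.ne'
  rw [hP]
  exact aeval_pow_eq_of_coprime hpos hζ hk (by simpa using (hP 1).symm.trans (by simpa using hq))

theorem RUQ_conj {f : G → ℂ} (hf : f ∈ RUQ G) (x g : G) : f (x * g * x⁻¹) = f g := by
  obtain ⟨n, c, V, rfl⟩ := hf
  simp [FDRep.char_conj]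

theorem RUQ_eq_of_subConj {f : G → ℂ} (hf : f ∈ RUQ G) {C : Subgroup G} {g h : G}
    (hg : SubConj (Subgroup.zpowers g) C) (hh : SubConj (Subgroup.zpowers h) C) {q : ℚ}
    (hq : f g = q) : f h = q := by
  obtain ⟨x, hx⟩ := (subConj_iff _ _).1 hg
  obtain ⟨y, hy⟩ := (subConj_iff _ _).1 hh
  rw [conj_smul_zpowers] at hx hy
  rw [← RUQ_conj hf x] at hq
  rw [← RUQ_conj hf y]
  exact RUQ_eq_of_zpowers_eq hf (hx.trans hy.symm) hq

end Trace

/-- STATEMENT 17: for any cyclic subgroup `C ≤ G`, the function `e_C` lies in `RU_ℚ(G)`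
and is a primitive idempotent of the ring `RU_ℚ(G)`. -/
theorem eCyc_primitive_idempotent_rational (G : Type) [Group G] [Fintype G]
    (C : Subgroup G) (hC : IsCyclic C) :
    eCyc C ∈ RUQ G ∧ IsPrimitiveIdempotentIn (RUQ G) (eCyc C) := by
  refine ⟨eCyc_mem_RUQ C, eCyc_mem_RUQ C, ?_, ?_, ?_⟩
  · ext g
    by_cases h : SubConj (Subgroup.zpowers g) C <;> simp [eCyc, h]
  · obtain ⟨g, hg⟩ := (Subgroup.isCyclic_iff_exists_zpowers_eq_top C).1 hC
    intro h
    have h1 := congrFun h g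
    have hs : SubConj (Subgroup.zpowers g) C := (subConj_iff _ _).2 ⟨1, by simp [hg]⟩
    simp [eCyc, hs] at h1
  · intro e₁ e₂ h₁ h₂ hi₁ hi₂ h12 he
    by_contra! hne
    obtain ⟨g, hg⟩ := Function.ne_iff.1 hne.1
    obtain ⟨h, hh⟩ := Function.ne_iff.1 hne.2
    have hmul (x : G) : e₁ x * e₂ x = 0 := congrFun h12 x
    have hadd (x : G) : eCyc C x = e₁ x + e₂ x := congrFun he x
    have hsupp {x : G} (hx : eCyc C x ≠ 0) : SubConj (Subgroup.zpowers x) C := by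
      by_contra hc
      exact hx (if_neg hc)
    have hg1 : e₁ g = 1 := by
      have := congrFun hi₁ g
      simpa [mul_eq_left₀ hg] using this
    have hg2 : e₂ g = 0 := (mul_eq_zero.1 (hmul g)).resolve_left hg
    have hh1 : e₁ h = 0 := (mul_eq_zero.1 (hmul h)).resolve_right hh
    have hsg : SubConj (Subgroup.zpowers g) C := hsupp (by simp [hadd, hg1, hg2])
    have hsh : SubConj (Subgroup.zpowers h) C := hsupp (by simpa [hadd, hh1] using hh)
    have := RUQ_eq_of_subConj h₁ hsg hsh (q := 1) (by simp [hg1])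
    simp [hh1] at this
end
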